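/- Fix an integer N ≥ 2, β > 0, μ₀ ∈ ℝ and σ > 0. Let a_1,…,a_N, b_1,…,b_{N−1} be independent real random variables with a_n distributed as the Gaussian distribution with mean μ₀ and variance σ², and b_n distributed as the Gamma distribution with shape β(N−n)/2 and scale σ². Then the joint law of the decreasingly ordered eigenvalues (x_1 > … > x_N) of the random Jacobi matrix J_{a,b} is the probability measure on ℝ^N proportional to |Δ(x_1,…,x_N)|^β ∏_{n=1}^N exp(−(x_n−μ₀)²/(2σ²)) restricted to the open chamber {x ∈ ℝ^N : x_1 > … > x_N}. Equivalently, the eigenvalues of J_{a,b} form the Hermite β-ensemble with potential V(x) = (x−μ₀)²/(2σ²). -/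

import Mathlib

open MeasureTheory ProbabilityTheory Matrix Finset Real
open scoped ENNReal NNReal

noncomputable section

/-- The symmetric tridiagonal (Jacobi) matrix with diagonal `a` and
off-diagonal entries `√(b n)`. -/
def jacobiMatrix {N : ℕ} (a : Fin N → ℝ) (b : Fin (N - 1) → ℝ) :
    Matrix (Fin N) (Fin N) ℝ :=
  Matrix.of fun i j =>
    if i = j then a i
    else if h : (i : ℕ) + 1 = (j : ℕ) then
      Real.sqrt (b ⟨i, by have := j.isLt; omega⟩)
    else if h' : (j : ℕ) + 1 = (i : ℕ) then
      Real.sqrt (b ⟨j, by have := i.isLt; omega⟩)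
    else 0

lemma jacobiMatrix_isHermitian {N : ℕ} (a : Fin N → ℝ) (b : Fin (N - 1) → ℝ) :
    (jacobiMatrix a b).IsHermitian := by
  unfold Matrix.IsHermitian
  ext i j
  simp only [jacobiMatrix, Matrix.conjTranspose_apply, Matrix.of_apply, star_trivial]
  by_cases hij : i = j
  · subst hij; simp
  · have hji : j ≠ i := fun h => hij h.symm
    rw [if_neg hji, if_neg hij]
    by_cases h1 : (j : ℕ) + 1 = (i : ℕ)
    · have h2 : ¬((i : ℕ) + 1 = (j : ℕ)) := by omega
      rw [dif_pos h1, dif_neg h2, dif_pos h1]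
    · by_cases h2 : (i : ℕ) + 1 = (j : ℕ)
      · rw [dif_neg h1, dif_pos h2, dif_pos h2]
      · rw [dif_neg h1, dif_neg h2, dif_neg h2, dif_neg h1]

/-- Reordering of a finite tuple in decreasing order. -/
def sortDesc {N : ℕ} (v : Fin N → ℝ) : Fin N → ℝ :=
  fun i => v (Tuple.sort v (Fin.rev i))

/-- The eigenvalues of the Jacobi matrix `J_{a,b}`, in decreasing order. -/
def jacobiEigs {N : ℕ} (a : Fin N → ℝ) (b : Fin (N - 1) → ℝ) : Fin N → ℝ :=
  sortDesc (jacobiMatrix_isHermitian a b).eigenvalues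

/-- The squared first coordinates of unit eigenvectors of the Jacobi matrix `J_{a,b}`,
indexed compatibly with `jacobiEigs` (decreasing eigenvalue order):
`jacobiWeights hN a b i` is the squared first coordinate of a unit eigenvector
associated with the eigenvalue `jacobiEigs a b i`. -/
def jacobiWeights {N : ℕ} (hN : 0 < N) (a : Fin N → ℝ) (b : Fin (N - 1) → ℝ) :
    Fin N → ℝ :=
  fun i =>
    ((jacobiMatrix_isHermitian a b).eigenvectorBasis
        (Tuple.sort (jacobiMatrix_isHermitian a b).eigenvalues (Fin.rev i)) ⟨0, hN⟩) ^ 2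

/-- The spectral map: Jacobi data `(a, b)` is sent to the decreasingly ordered
eigenvalues together with the first `N - 1` spectral weights. -/
def spectralMap {N : ℕ} (hN : 0 < N) (a : Fin N → ℝ) (b : Fin (N - 1) → ℝ) :
    (Fin N → ℝ) × (Fin (N - 1) → ℝ) :=
  ⟨jacobiEigs a b, fun i => jacobiWeights hN a b ⟨i, by have := i.isLt; omega⟩⟩

/-- The Vandermonde product `∏_{i<j} (x j - x i)`. -/
def vdm {N : ℕ} (x : Fin N → ℝ) : ℝ :=
  ∏ i : Fin N, ∏ j ∈ Finset.Ioi i, (x j - x i)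

/-- The open chamber of decreasing vectors `x 0 > x 1 > … `. -/
def chamber (N : ℕ) : Set (Fin N → ℝ) := {x | ∀ i j : Fin N, i < j → x j < x i}

/-- The open simplex of positive weights with sum `< 1`. -/
def openSimplex (N : ℕ) : Set (Fin (N - 1) → ℝ) :=
  {w | (∀ i, 0 < w i) ∧ ∑ i, w i < 1}

/-- Extension of `N - 1` weights by the last weight `1 - ∑ w`. -/
def wExt {N : ℕ} (w : Fin (N - 1) → ℝ) : Fin N → ℝ :=
  fun n => if h : (n : ℕ) < N - 1 then w ⟨n, h⟩ else 1 - ∑ i, w i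

/-- The first `N` coordinates of a vector of length `2N - 1`. -/
def xPart {N : ℕ} (p : Fin (2 * N - 1) → ℝ) : Fin N → ℝ :=
  fun i => p ⟨i, by have := i.isLt; omega⟩

/-- The last `N - 1` coordinates of a vector of length `2N - 1`. -/
def wPart {N : ℕ} (p : Fin (2 * N - 1) → ℝ) : Fin (N - 1) → ℝ :=
  fun i => p ⟨N + i, by have := i.isLt; omega⟩

/-- The diagonal coefficients `a` built from the parameters `ξ`:
`a 1 = ξ 1`, `a n = ξ (2n-2) + ξ (2n-1)` (in one-based notation). -/
def xiToA {N : ℕ} (ξ : Fin (2 * N - 1) → ℝ) : Fin N → ℝ :=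
  fun n =>
    if h : (n : ℕ) = 0 then ξ ⟨0, by have := n.isLt; omega⟩
    else ξ ⟨2 * (n : ℕ) - 1, by have := n.isLt; omega⟩ +
      ξ ⟨2 * (n : ℕ), by have := n.isLt; omega⟩

/-- The off-diagonal coefficients `b` built from the parameters `ξ`:
`b n = ξ (2n-1) * ξ (2n)` (in one-based notation). -/
def xiToB {N : ℕ} (ξ : Fin (2 * N - 1) → ℝ) : Fin (N - 1) → ℝ :=
  fun n => ξ ⟨2 * (n : ℕ), by have := n.isLt; omega⟩ *
    ξ ⟨2 * (n : ℕ) + 1, by have := n.isLt; omega⟩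

/-- The chain-sequence parameters `ξ` built from canonical moments `c`:
`ξ 1 = c 1` and `ξ n = (1 - c (n-1)) * c n` (in one-based notation). -/
def cToXi {N : ℕ} (c : Fin (2 * N - 1) → ℝ) : Fin (2 * N - 1) → ℝ :=
  fun k =>
    if (k : ℕ) = 0 then c k
    else (1 - c ⟨(k : ℕ) - 1, by have := k.isLt; omega⟩) * c k

/-- The lower bidiagonal matrix `Ξ` with diagonal `√ξ 1, √ξ 3, …` and
subdiagonal `√ξ 2, √ξ 4, …` (in one-based notation). -/
def bidiag {N : ℕ} (ξ : Fin (2 * N - 1) → ℝ) : Matrix (Fin N) (Fin N) ℝ :=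
  Matrix.of fun i j =>
    if i = j then Real.sqrt (ξ ⟨2 * (i : ℕ), by have := i.isLt; omega⟩)
    else if h : (j : ℕ) + 1 = (i : ℕ) then
      Real.sqrt (ξ ⟨2 * (j : ℕ) + 1, by have := i.isLt; omega⟩)
    else 0

lemma mul_transpose_isHermitian {N : ℕ} (A : Matrix (Fin N) (Fin N) ℝ) :
    (A * Aᵀ).IsHermitian := by
  unfold Matrix.IsHermitian
  ext i j
  simp [Matrix.mul_apply, Matrix.conjTranspose_apply, Matrix.transpose_apply, mul_comm]


section
open Polynomial

/-- The monic polynomial with roots `x i`. -/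
def nod {n : ℕ} (x : Fin n → ℝ) : ℝ[X] := ∏ i, (X - C (x i))

/-- The product over all nodes but the `k`-th. -/
def nodE {n : ℕ} (x : Fin n → ℝ) (k : Fin n) : ℝ[X] := ∏ i ∈ univ.erase k, (X - C (x i))

/-- The derivative of `nod x` at the node `x k`. -/
def nodD {n : ℕ} (x : Fin n → ℝ) (k : Fin n) : ℝ := ∏ i ∈ univ.erase k, (x k - x i)

lemma nod_monic {n : ℕ} (x : Fin n → ℝ) : (nod x).Monic :=
  monic_prod_of_monic _ _ fun i _ => monic_X_sub_C (x i)

lemma nodE_monic {n : ℕ} (x : Fin n → ℝ) (k : Fin n) : (nodE x k).Monic :=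
  monic_prod_of_monic _ _ fun i _ => monic_X_sub_C (x i)

lemma nod_natDegree {n : ℕ} (x : Fin n → ℝ) : (nod x).natDegree = n := by
  simp [nod]

lemma nodE_natDegree {n : ℕ} (x : Fin n → ℝ) (k : Fin n) : (nodE x k).natDegree = n - 1 := by
  simp [nodE]

lemma nod_degree {n : ℕ} (x : Fin n → ℝ) : (nod x).degree = n := by
  rw [degree_eq_natDegree (nod_monic x).ne_zero, nod_natDegree]

lemma nodE_degree_lt {n : ℕ} (x : Fin n → ℝ) (k : Fin n) : (nodE x k).degree < n := by
  rw [degree_eq_natDegree (nodE_monic x k).ne_zero, nodE_natDegree]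
  have := k.pos
  exact_mod_cast (by omega : n - 1 < n)

lemma nodE_mul {n : ℕ} (x : Fin n → ℝ) (k : Fin n) : (X - C (x k)) * nodE x k = nod x := by
  exact Finset.mul_prod_erase univ (fun i => X - C (x i)) (mem_univ k)

lemma nod_eval {n : ℕ} (x : Fin n → ℝ) (t : ℝ) : (nod x).eval t = ∏ i, (t - x i) := by
  simp [nod, eval_prod]

lemma nodE_eval {n : ℕ} (x : Fin n → ℝ) (k : Fin n) (t : ℝ) :
    (nodE x k).eval t = ∏ i ∈ univ.erase k, (t - x i) := by
  simp [nodE, eval_prod]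

lemma nod_eval_self {n : ℕ} (x : Fin n → ℝ) (k : Fin n) : (nod x).eval (x k) = 0 := by
  rw [nod_eval]; exact Finset.prod_eq_zero (mem_univ k) (by simp)

lemma nodE_eval_self {n : ℕ} (x : Fin n → ℝ) (k : Fin n) : (nodE x k).eval (x k) = nodD x k := by
  rw [nodE_eval]; rfl

lemma nodE_eval_ne {n : ℕ} (x : Fin n → ℝ) (k j : Fin n) (h : j ≠ k) :
    (nodE x k).eval (x j) = 0 := by
  rw [nodE_eval]; exact Finset.prod_eq_zero (i := j) (by simp [h]) (by simp)

lemma nodD_ne {n : ℕ} {x : Fin n → ℝ} (hx : Function.Injective x) (k : Fin n) : nodD x k ≠ 0 := by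
  refine Finset.prod_ne_zero_iff.2 fun i hi => ?_
  rw [sub_ne_zero]
  intro h
  exact (Finset.ne_of_mem_erase hi) (hx h).symm

lemma sum_nodE_eval {n : ℕ} (x q : Fin n → ℝ) (k : Fin n) :
    (∑ j, C (q j) * nodE x j).eval (x k) = q k * nodD x k := by
  rw [eval_finsetSum, Finset.sum_eq_single k]
  · simp [nodE_eval_self]
  · intro j _ hj
    simp [nodE_eval_ne x j k hj.symm]
  · simp

lemma sum_nodE_degree_lt {n : ℕ} (x q : Fin n → ℝ) :
    (∑ j, C (q j) * nodE x j).degree < n := by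
  rw [← mem_degreeLT]
  refine Submodule.sum_mem _ fun j _ => ?_
  rw [mem_degreeLT]
  refine lt_of_le_of_lt ?_ (nodE_degree_lt x j)
  rw [C_mul']
  exact degree_smul_le _ _

/-- Lagrange interpolation. -/
lemma lagr {n : ℕ} {x : Fin n → ℝ} (hx : Function.Injective x) {p : ℝ[X]} (hp : p.degree < n)
    (q : Fin n → ℝ) (h : ∀ k, p.eval (x k) = q k * nodD x k) :
    p = ∑ j, C (q j) * nodE x j := by
  refine eq_of_degrees_lt_of_eval_index_eq (s := univ) (v := x) (hx.injOn) (by simpa using hp)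
    (by simpa using sum_nodE_degree_lt x q) fun i _ => ?_
  rw [h, sum_nodE_eval]

/-- A polynomial of degree at most `n` with `n` distinct roots. -/
lemma eq_C_mul_nod {n : ℕ} {x : Fin n → ℝ} (hx : Function.Injective x) {p : ℝ[X]}
    (hp : p.degree ≤ n) (h : ∀ k, p.eval (x k) = 0) : p = C (p.coeff n) * nod x := by
  refine eq_of_degree_sub_lt_of_eval_index_eq (s := univ) (v := x) (hx.injOn) ?_ fun i _ => ?_
  · simp only [card_univ, Fintype.card_fin]
    rw [degree_lt_iff_coeff_zero]
    intro m hm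
    rcases hm.eq_or_lt with rfl | hm
    · have : (nod x).coeff n = 1 := by
        have := nod_monic x
        rwa [Monic, leadingCoeff, nod_natDegree] at this
      simp [this]
    · have h1 : p.coeff m = 0 := coeff_eq_zero_of_degree_lt (lt_of_le_of_lt hp (by exact_mod_cast hm))
      have h2 : (nod x).coeff m = 0 :=
        coeff_eq_zero_of_degree_lt (by rw [nod_degree]; exact_mod_cast hm)
      simp [h1, h2]
  · simp [h, nod_eval_self]

lemma nod_coeff_top {n : ℕ} (x : Fin n → ℝ) : (nod x).coeff n = 1 := by
  have := nod_monic x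
  rwa [Monic, leadingCoeff, nod_natDegree] at this

lemma nodE_coeff_top {n : ℕ} (x : Fin (n+1) → ℝ) (k) : (nodE x k).coeff n = 1 := by
  have := nodE_monic x k
  rwa [Monic, leadingCoeff, nodE_natDegree] at this

lemma nod_coeff_pred {n : ℕ} (x : Fin (n + 1) → ℝ) : (nod x).coeff n = - ∑ i, x i := by
  have := prod_X_sub_C_coeff_card_pred (univ : Finset (Fin (n+1))) x (by simp)
  simpa [nod] using this

lemma chamber_strictAnti {n : ℕ} {x : Fin n → ℝ} (hx : x ∈ chamber n) : StrictAnti x :=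
  fun i j h => hx i j h

lemma chamber_inj {n : ℕ} {x : Fin n → ℝ} (hx : x ∈ chamber n) : Function.Injective x :=
  (chamber_strictAnti hx).injective

/-- A point of the chamber is determined by its polynomial. -/
lemma nod_inj {n : ℕ} {x x' : Fin n → ℝ} (hx : x ∈ chamber n) (hx' : x' ∈ chamber n)
    (h : nod x = nod x') : x = x' := by
  have hr : Set.range x = Set.range x' := by
    ext t
    have : (nod x).eval t = 0 ↔ (nod x').eval t = 0 := by rw [h]
    simp only [nod_eval, Finset.prod_eq_zero_iff, Finset.mem_univ, true_and, sub_eq_zero] at this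
    simp only [Set.mem_range]
    constructor
    · rintro ⟨i, rfl⟩
      obtain ⟨j, hj⟩ := this.1 ⟨i, rfl⟩
      exact ⟨j, hj.symm⟩
    · rintro ⟨i, rfl⟩
      obtain ⟨j, hj⟩ := this.2 ⟨i, rfl⟩
      exact ⟨j, hj.symm⟩
  have h1 : StrictMono (fun i => - x i) := fun i j hij => neg_lt_neg (hx i j hij)
  have h2 : StrictMono (fun i => - x' i) := fun i j hij => neg_lt_neg (hx' i j hij)
  have := (StrictMono.range_inj h1 h2).1 (by
    have e1 : Set.range (fun i => - x i) = Neg.neg '' Set.range x := by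
      rw [← Set.range_comp]; rfl
    have e2 : Set.range (fun i => - x' i) = Neg.neg '' Set.range x' := by
      rw [← Set.range_comp]; rfl
    rw [e1, e2, hr])
  funext i
  have := congrFun this i
  simpa using this

/-- Intllacing. -/
def Intl {n : ℕ} (x : Fin (n + 1) → ℝ) (y : Fin n → ℝ) : Prop :=
  ∀ j : Fin n, y j < x j.castSucc ∧ x j.succ < y j

lemma Intl.left {n : ℕ} {x : Fin (n + 1) → ℝ} {y : Fin n → ℝ} (h : Intl x y) :
    x ∈ chamber (n + 1) := by
  have : StrictAnti x := Fin.strictAnti_iff_succ_lt.2 fun j => (h j).2.trans (h j).1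
  exact fun i j hij => this hij

lemma Intl.right {n : ℕ} {x : Fin (n + 1) → ℝ} {y : Fin n → ℝ} (h : Intl x y) :
    y ∈ chamber n := by
  intro i j hij
  have h1 := (h j).1
  have h2 := (h i).2
  have h3 : x j.castSucc ≤ x i.succ := (chamber_strictAnti h.left).antitone (by
    rw [Fin.le_iff_val_le_val]; simp; omega)
  linarith

/-- Coefficient map of stage one: `(a, q)` as a function of `x`, for fixed `y`. -/
def fA {n : ℕ} (y : Fin n → ℝ) (x : Fin (n + 1) → ℝ) : ℝ := ∑ i, x i - ∑ j, y j

def fQ {n : ℕ} (y : Fin n → ℝ) (x : Fin (n + 1) → ℝ) (j : Fin n) : ℝ :=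
  - (∏ i, (y j - x i)) / nodD y j

/-- Weights in terms of `(b, y)`, for fixed `x`. -/
def fW {n : ℕ} (x : Fin (n + 1) → ℝ) (b : ℝ) (y : Fin n → ℝ) (j : Fin (n + 1)) : ℝ :=
  b * (∏ i, (x j - y i)) / nodD x j

lemma relA {n : ℕ} {y : Fin n → ℝ} (hy : Function.Injective y) (x : Fin (n + 1) → ℝ) :
    nod x = (X - C (fA y x)) * nod y - ∑ j, C (fQ y x j) * nodE y j := by
  have key : nod x - (X - C (fA y x)) * nod y = ∑ j, C (- fQ y x j) * nodE y j := by
    apply lagr hy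
    · rw [degree_lt_iff_coeff_zero]
      intro m hm
      have hm1 : ((X - C (fA y x)) * nod y).Monic := (monic_X_sub_C _).mul (nod_monic y)
      have hd1 : ((X - C (fA y x)) * nod y).natDegree = n + 1 := by
        rw [(monic_X_sub_C _).natDegree_mul (nod_monic y), nod_natDegree]; simp [add_comm]
      rcases hm.eq_or_lt with rfl | hm
      · rw [coeff_sub, nod_coeff_pred, sub_mul, coeff_sub, coeff_C_mul, nod_coeff_top]
        cases n with
        | zero => simp [fA]
        | succ k =>
          rw [coeff_X_mul, nod_coeff_pred]
          simp [fA]; ring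
      · rcases (Nat.succ_le_of_lt hm).eq_or_lt with rfl | hm
        · rw [coeff_sub, nod_coeff_top]
          have : ((X - C (fA y x)) * nod y).coeff (n+1) = 1 := by
            rw [← hd1]; exact hm1
          rw [Nat.succ_eq_add_one, this, sub_self]
        · rw [coeff_sub, coeff_eq_zero_of_natDegree_lt (by rw [nod_natDegree]; exact hm),
            coeff_eq_zero_of_natDegree_lt (by rw [hd1]; exact hm), sub_self]
    · intro k
      have := nodD_ne hy k
      simp only [eval_sub, eval_mul, nod_eval_self, nod_eval x, fQ]
      field_simp
      simp
  rw [sub_eq_iff_eq_add] at key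
  rw [key]
  simp only [map_neg, neg_mul, Finset.sum_neg_distrib]
  ring

lemma relW {n : ℕ} {x : Fin (n + 1) → ℝ} (hx : Function.Injective x) (b : ℝ) (y : Fin n → ℝ) :
    C b * nod y = ∑ j, C (fW x b y j) * nodE x j := by
  apply lagr hx
  · rw [C_mul']
    refine lt_of_le_of_lt (degree_smul_le _ _) ?_
    rw [nod_degree]; exact_mod_cast Nat.lt_succ_self n
  · intro k
    have := nodD_ne hx k
    simp only [eval_mul, eval_C, nod_eval, fW]
    field_simp

lemma sum_fW {n : ℕ} {x : Fin (n + 1) → ℝ} (hx : Function.Injective x) (b : ℝ) (y : Fin n → ℝ) :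
    ∑ j, fW x b y j = b := by
  have := congrArg (fun p => coeff p n) (relW hx b y)
  simp only [coeff_C_mul, nod_coeff_top, finsetSum_coeff, nodE_coeff_top, mul_one] at this
  exact this.symm


lemma sgn_prod {ι : Type*} (s : Finset ι) (P : ι → Prop) [DecidablePred P] (f : ι → ℝ)
    (h1 : ∀ i ∈ s, P i → f i < 0) (h2 : ∀ i ∈ s, ¬ P i → 0 < f i) (c : ℕ)
    (hc : (s.filter P).card = c) : 0 < (-1) ^ c * ∏ i ∈ s, f i := by
  have : ((-1 : ℝ)) ^ c = ∏ i ∈ s, (if P i then (-1 : ℝ) else 1) := by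
    rw [Finset.prod_ite]; simp [hc]
  rw [this, ← Finset.prod_mul_distrib]
  refine Finset.prod_pos fun i hi => ?_
  by_cases h : P i
  · simp only [h, if_true]; linarith [h1 i hi h]
  · simp only [h, if_false]; linarith [h2 i hi h]

lemma sgn_nodD {n : ℕ} {y : Fin n → ℝ} (hy : y ∈ chamber n) (j : Fin n) :
    0 < (-1) ^ (j : ℕ) * nodD y j := by
  refine sgn_prod _ (fun i => i < j) _ ?_ ?_ _ ?_
  · intro i _ hij
    linarith [hy i j hij]
  · intro i hi hij
    have : j < i := lt_of_le_of_ne (not_lt.1 hij) (Finset.ne_of_mem_erase hi).symm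
    linarith [hy j i this]
  · have : (univ.erase j).filter (fun i => i < j) = Finset.Iio j := by
      ext i; simp; exact fun h => h.ne
    rw [this, Fin.card_Iio]

lemma Intl.lt_of_le {n : ℕ} {x : Fin (n + 1) → ℝ} {y : Fin n → ℝ} (h : Intl x y)
    (i : Fin (n + 1)) (j : Fin n) (hij : (i : ℕ) ≤ j) : y j < x i :=
  (h j).1.trans_le ((chamber_strictAnti h.left).antitone (by
    rw [Fin.le_iff_val_le_val]; simpa using hij))

lemma Intl.gt_of_lt {n : ℕ} {x : Fin (n + 1) → ℝ} {y : Fin n → ℝ} (h : Intl x y)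
    (i : Fin (n + 1)) (j : Fin n) (hij : (j : ℕ) < i) : x i < y j :=
  lt_of_le_of_lt ((chamber_strictAnti h.left).antitone (by
    rw [Fin.le_iff_val_le_val]; simpa using hij)) (h j).2

lemma sgn_yx {n : ℕ} {x : Fin (n + 1) → ℝ} {y : Fin n → ℝ} (h : Intl x y) (j : Fin n) :
    0 < (-1) ^ (j + 1 : ℕ) * ∏ i, (y j - x i) := by
  refine sgn_prod _ (fun i : Fin (n + 1) => (i : ℕ) ≤ j) _ ?_ ?_ _ ?_
  · intro i _ hij
    linarith [h.lt_of_le i j hij]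
  · intro i hi hij
    linarith [h.gt_of_lt i j (not_le.1 hij)]
  · have : (univ : Finset (Fin (n+1))).filter (fun i : Fin (n + 1) => (i : ℕ) ≤ j) = Finset.Iic j.castSucc := by
      ext i; simp [Fin.le_iff_val_le_val]
    rw [this, Fin.card_Iic]; simp

lemma sgn_xy {n : ℕ} {x : Fin (n + 1) → ℝ} {y : Fin n → ℝ} (h : Intl x y) (j : Fin (n + 1)) :
    0 < (-1) ^ (j : ℕ) * ∏ i, (x j - y i) := by
  refine sgn_prod _ (fun i : Fin n => (i : ℕ) < j) _ ?_ ?_ _ ?_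
  · intro i _ hij
    linarith [h.gt_of_lt j i hij]
  · intro i hi hij
    linarith [h.lt_of_le j i (not_lt.1 hij)]
  · have h1 := Fin.card_filter_val_lt (n := n) (m := (j : ℕ))
    rw [h1]
    omega

lemma div_pos_of_sgn {k : ℕ} {u v : ℝ} (hu : 0 < (-1) ^ k * u) (hv : 0 < (-1) ^ k * v) :
    0 < u / v := by
  rcases neg_one_pow_eq_or ℝ k with h | h <;> rw [h] at hu hv
  · exact div_pos (by linarith) (by linarith)
  · exact div_pos_of_neg_of_neg (by linarith) (by linarith)

lemma fQ_pos {n : ℕ} {x : Fin (n + 1) → ℝ} {y : Fin n → ℝ} (h : Intl x y) (j : Fin n) :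
    0 < fQ y x j := by
  refine div_pos_of_sgn (k := j) ?_ (sgn_nodD h.right j)
  have := sgn_yx h j
  rw [pow_succ] at this
  linarith

lemma fW_pos {n : ℕ} {x : Fin (n + 1) → ℝ} {y : Fin n → ℝ} (h : Intl x y) {b : ℝ} (hb : 0 < b)
    (j : Fin (n + 1)) : 0 < fW x b y j := by
  unfold fW
  rw [mul_div_assoc]
  exact mul_pos hb (div_pos_of_sgn (k := j) (sgn_xy h j) (sgn_nodD h.left j))

lemma ivt_roots {m : ℕ} (p : ℝ[X]) (t : Fin (m + 1) → ℝ) (ht : StrictAnti t)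
    (h : ∀ i : Fin (m + 1), 0 < (-1) ^ (i : ℕ) * p.eval (t i)) :
    ∃ r : Fin m → ℝ, ∀ i, t i.succ < r i ∧ r i < t i.castSucc ∧ p.eval (r i) = 0 := by
  have : ∀ i : Fin m, ∃ r, t i.succ < r ∧ r < t i.castSucc ∧ p.eval r = 0 := by
    intro i
    have hlt : t i.succ < t i.castSucc := ht Fin.castSucc_lt_succ
    have h1 := h i.succ
    have h2 := h i.castSucc
    simp only [Fin.val_succ, Fin.val_castSucc, pow_succ] at h1 h2
    have hc : ContinuousOn (fun z => p.eval z) (Set.Icc (t i.succ) (t i.castSucc)) :=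
      p.continuous.continuousOn
    rcases neg_one_pow_eq_or ℝ (i : ℕ) with e | e <;> rw [e] at h1 h2
    · obtain ⟨r, hr, hr0⟩ := intermediate_value_Ioo hlt.le hc
        (show (0 : ℝ) ∈ Set.Ioo _ _ from ⟨by linarith, by linarith⟩)
      exact ⟨r, hr.1, hr.2, hr0⟩
    · obtain ⟨r, hr, hr0⟩ := intermediate_value_Ioo' hlt.le hc
        (show (0 : ℝ) ∈ Set.Ioo _ _ from ⟨by linarith, by linarith⟩)
      exact ⟨r, hr.1, hr.2, hr0⟩
  choose r hr using this
  exact ⟨r, hr⟩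

lemma surjW {n : ℕ} {x : Fin (n + 1) → ℝ} (hx : x ∈ chamber (n + 1)) {q : Fin (n + 1) → ℝ}
    (hq : ∀ j, 0 < q j) : ∃ b y, 0 < b ∧ Intl x y ∧ fW x b y = q := by
  set p : ℝ[X] := ∑ j, C (q j) * nodE x j with hp
  obtain ⟨y, hy⟩ := ivt_roots p x (chamber_strictAnti hx) (fun i => by
    rw [hp, sum_nodE_eval]
    have := mul_pos (hq i) (sgn_nodD hx i)
    linarith)
  have hI : Intl x y := fun j => ⟨(hy j).2.1, (hy j).1⟩
  have hd : p.degree ≤ n := by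
    have := sum_nodE_degree_lt x q
    rw [← hp] at this
    exact Order.lt_succ_iff.1 this
  have he := eq_C_mul_nod (chamber_inj hI.right) hd (fun k => (hy k).2.2)
  have hb : p.coeff n = ∑ j, q j := by
    simp [hp, finsetSum_coeff, nodE_coeff_top]
  refine ⟨p.coeff n, y, ?_, hI, ?_⟩
  · rw [hb]; exact Finset.sum_pos (fun j _ => hq j) ⟨0, by simp⟩
  · funext j
    have h1 : p.eval (x j) = p.coeff n * ∏ i, (x j - y i) := by
      conv_lhs => rw [he]
      simp [nod_eval]
    have h2 : p.eval (x j) = q j * nodD x j := sum_nodE_eval x q j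
    rw [fW, ← h1, h2]
    field_simp [nodD_ne (chamber_inj hx) j]

lemma exists_ends {p : ℝ[X]} {m : ℕ} (hp : p.Monic) (hd : p.natDegree = m + 1) (B : ℝ) :
    (∃ M, B < M ∧ 0 < p.eval M) ∧ (∃ M, M < B ∧ 0 < (-1) ^ (m + 1) * p.eval M) := by
  have key : ∀ (r : ℝ[X]) (B : ℝ), r.Monic → r.natDegree = m + 1 → ∃ M, B < M ∧ 0 < r.eval M := by
    intro r B hr hrd
    have ht := r.tendsto_atTop_of_leadingCoeff_nonneg
      (by rw [degree_eq_natDegree hr.ne_zero, hrd]; exact_mod_cast Nat.succ_pos m)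
      (by rw [hr.leadingCoeff]; norm_num)
    obtain ⟨M, h1, h2⟩ := ((ht.eventually_gt_atTop 0).and (Filter.eventually_gt_atTop B)).exists
    exact ⟨M, h2, h1⟩
  refine ⟨key p B hp hd, ?_⟩
  have hm := hp.neg_one_pow_natDegree_mul_comp_neg_X
  rw [hd] at hm
  obtain ⟨M, h1, h2⟩ := key _ (-B) hm (by
    have : ((-1 : ℝ[X]) ^ (m + 1)) = C ((-1) ^ (m + 1)) := by simp
    rw [this, natDegree_C_mul (by simp), natDegree_comp, hd]; simp)
  refine ⟨-M, by linarith, ?_⟩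
  simpa [eval_comp] using h2

lemma arrow_monic {n : ℕ} (y : Fin n → ℝ) (a : ℝ) (q : Fin n → ℝ) :
    ((X - C a) * nod y - ∑ j, C (q j) * nodE y j).Monic ∧
    ((X - C a) * nod y - ∑ j, C (q j) * nodE y j).natDegree = n + 1 := by
  have hm1 : ((X - C a) * nod y).Monic := (monic_X_sub_C _).mul (nod_monic y)
  have hd1 : ((X - C a) * nod y).natDegree = n + 1 := by
    rw [(monic_X_sub_C _).natDegree_mul (nod_monic y), nod_natDegree]; simp [add_comm]
  have hlt : (∑ j, C (q j) * nodE y j).degree < ((X - C a) * nod y).degree := by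
    refine (sum_nodE_degree_lt y q).trans ?_
    rw [degree_eq_natDegree hm1.ne_zero, hd1]; exact_mod_cast Nat.lt_succ_self n
  exact ⟨hm1.sub_of_left hlt, by
    rw [natDegree_sub_eq_left_of_natDegree_lt, hd1]
    rw [hd1]
    have := sum_nodE_degree_lt y q
    by_cases h0 : (∑ j, C (q j) * nodE y j) = 0
    · rw [h0]; simp
    · rw [degree_eq_natDegree h0] at this
      have : (∑ j, C (q j) * nodE y j).natDegree < n := by exact_mod_cast this
      omega⟩

lemma surjA {n : ℕ} {y : Fin n → ℝ} (hy : y ∈ chamber n) (a : ℝ) {q : Fin n → ℝ}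
    (hq : ∀ j, 0 < q j) : ∃ x, Intl x y ∧ fA y x = a ∧ fQ y x = q ∧
      nod x = (X - C a) * nod y - ∑ j, C (q j) * nodE y j := by
  obtain ⟨hpm, hpd⟩ := arrow_monic y a q
  set p : ℝ[X] := (X - C a) * nod y - ∑ j, C (q j) * nodE y j with hp
  have hpe : ∀ k, p.eval (y k) = - (q k * nodD y k) := fun k => by
    rw [hp, eval_sub, sum_nodE_eval, eval_mul, nod_eval_self]; ring
  obtain ⟨B, hB⟩ : ∃ B : ℝ, ∀ j, |y j| < B := ⟨∑ j, |y j| + 1, fun j => by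
    have := Finset.single_le_sum (f := fun j => |y j|) (fun i _ => abs_nonneg _) (mem_univ j)
    linarith⟩
  obtain ⟨M, hM, hMp⟩ := (exists_ends hpm hpd (max B 0)).1
  obtain ⟨m, hm, hmp⟩ := (exists_ends hpm hpd (-(max B 0))).2
  have hB0 := le_max_right B 0
  have hB1 := le_max_left B 0
  have hyM : ∀ j, y j < M := fun j => by linarith [(abs_lt.1 (hB j)).2]
  have hym : ∀ j, m < y j := fun j => by linarith [(abs_lt.1 (hB j)).1]
  let s : Fin (n + 1) → ℝ := Fin.snoc y m
  let t : Fin (n + 2) → ℝ := Fin.cons M s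
  have hsM : ∀ i, s i < M := by
    intro i
    refine Fin.lastCases ?_ (fun j => ?_) i
    · simp only [s, Fin.snoc_last]; linarith
    · simp only [s, Fin.snoc_castSucc]; exact hyM j
  have hsy : ∀ i j, Fin.castSucc j < i → s i < y j := by
    intro i j
    refine Fin.lastCases ?_ (fun k => ?_) i
    · intro _; simp only [s, Fin.snoc_last]; exact hym j
    · intro h; simp only [s, Fin.snoc_castSucc]; exact hy j k (by simpa using h)
  have ht : StrictAnti t := by
    refine Fin.strictAnti_iff_succ_lt.2 fun i => ?_
    refine Fin.cases ?_ (fun j => ?_) i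
    · simpa [t] using hsM 0
    · have : t j.succ.castSucc = y j := by
        rw [← Fin.succ_castSucc]; simp [t, s]
      rw [this]
      simpa [t] using hsy j.succ j Fin.castSucc_lt_succ
  obtain ⟨x, hx⟩ := ivt_roots p t ht (fun i => by
    refine Fin.cases ?_ (fun j => ?_) i
    · simpa [t] using hMp
    · refine Fin.lastCases ?_ (fun k => ?_) j
      · simpa [t, s] using hmp
      · simp only [t, s, Fin.cons_succ, Fin.snoc_castSucc, hpe, Fin.val_succ, Fin.val_castSucc]
        have := mul_pos (hq k) (sgn_nodD hy k)
        rw [pow_succ]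
        linarith)
  have hI : Intl x y := fun j => by
    have h1 := (hx j.castSucc).1
    have h2 := (hx j.succ).2.1
    rw [← Fin.succ_castSucc] at h2
    simp only [t, s, Fin.cons_succ, Fin.snoc_castSucc] at h1 h2
    exact ⟨h1, h2⟩
  have he := eq_C_mul_nod (chamber_inj hI.left) (p := p)
    (by rw [degree_eq_natDegree hpm.ne_zero, hpd]) (fun k => (hx k).2.2)
  have hc : p.coeff (n + 1) = 1 := by rw [← hpd]; exact hpm
  rw [hc, C_1, one_mul] at he
  have hyi := chamber_inj hy
  have hQ : fQ y x = q := by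
    funext j
    have := hpe j
    rw [he, nod_eval] at this
    rw [fQ, this]
    field_simp [nodD_ne hyi j]
  refine ⟨x, hI, ?_, hQ, he.symm⟩
  have h1 := relA hyi x
  rw [← he, hQ, hp] at h1
  have h2 : (C (fA y x) - C a) * nod y = 0 := by linear_combination h1
  rcases mul_eq_zero.1 h2 with h3 | h3
  · exact C_injective (sub_eq_zero.1 h3)
  · exact absurd h3 (nod_monic y).ne_zero

lemma injA {n : ℕ} {y : Fin n → ℝ} {x x' : Fin (n + 1) → ℝ} (h : Intl x y) (h' : Intl x' y)
    (hA : fA y x = fA y x') (hQ : fQ y x = fQ y x') : x = x' := by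
  apply nod_inj h.left h'.left
  rw [relA (chamber_inj h.right) x, relA (chamber_inj h.right) x', hA, hQ]

lemma injW {n : ℕ} {x : Fin (n + 1) → ℝ} {y y' : Fin n → ℝ} (h : Intl x y) (h' : Intl x y')
    {b b' : ℝ} (hb : 0 < b) (hW : fW x b y = fW x b' y') : b = b' ∧ y = y' := by
  have hx := chamber_inj h.left
  have h1 : b = b' := by rw [← sum_fW hx b y, hW, sum_fW hx]
  refine ⟨h1, nod_inj h.right h'.right ?_⟩
  have h2 := relW hx b y
  rw [hW, ← relW hx, ← h1] at h2
  exact mul_left_cancel₀ (by simpa using hb.ne') h2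

def fL {n : ℕ} (y : Fin n → ℝ) (x : Fin (n + 1) → ℝ) : Fin (n + 1) → ℝ :=
  Fin.cons (fA y x) (fQ y x)

def fR {n : ℕ} (x : Fin (n + 1) → ℝ) (v : Fin (n + 1) → ℝ) : Fin (n + 1) → ℝ :=
  fW x (v 0) (fun i => v i.succ)

def matL {n : ℕ} (y : Fin n → ℝ) (x : Fin (n + 1) → ℝ) : Matrix (Fin (n + 1)) (Fin (n + 1)) ℝ :=
  Matrix.of fun r k => Fin.cases (motive := fun _ => ℝ) 1
    (fun j => (nodD y j)⁻¹ * (nodE x k).eval (y j)) r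

def matR {n : ℕ} (x : Fin (n + 1) → ℝ) (b : ℝ) (y : Fin n → ℝ) :
    Matrix (Fin (n + 1)) (Fin (n + 1)) ℝ :=
  Matrix.of fun r k => (nodD x r)⁻¹ * Fin.cases (motive := fun _ => ℝ) ((nod y).eval (x r))
    (fun j => - b * (nodE y j).eval (x r)) k

def toCLM {n : ℕ} (M : Matrix (Fin n) (Fin n) ℝ) : (Fin n → ℝ) →L[ℝ] (Fin n → ℝ) :=
  LinearMap.toContinuousLinearMap (Matrix.toLin' M)

lemma toCLM_det {n : ℕ} (M : Matrix (Fin n) (Fin n) ℝ) : (toCLM M).det = M.det := by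
  simp [toCLM]

lemma toCLM_apply {n : ℕ} (M : Matrix (Fin n) (Fin n) ℝ) (v : Fin n → ℝ) (r : Fin n) :
    toCLM M v r = ∑ k, M r k * v k := by
  simp [toCLM, Matrix.mulVec, dotProduct]

lemma hasFDerivAt_fL {n : ℕ} (y : Fin n → ℝ) (x : Fin (n + 1) → ℝ) :
    HasFDerivAt (fL y) (toCLM (matL y x)) x := by
  rw [hasFDerivAt_pi']
  intro r
  refine Fin.cases ?_ (fun j => ?_) r
  · have h : HasFDerivAt (fun x : Fin (n + 1) → ℝ => ∑ i, x i - ∑ j, y j)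
        (∑ i, ContinuousLinearMap.proj (R := ℝ) (φ := fun _ : Fin (n+1) => ℝ) i) x := by
      exact (HasFDerivAt.fun_sum fun i _ => hasFDerivAt_apply (𝕜 := ℝ) i x).sub_const _
    refine (h.congr_fderiv ?_)
    ext1 v
    simp [toCLM_apply, matL]
  · have h : HasFDerivAt (fun x : Fin (n + 1) → ℝ => ∏ i, (y j - x i)) _ x :=
      HasFDerivAt.finsetProd (u := univ) (g := fun i (x : Fin (n + 1) → ℝ) => y j - x i)
        fun i _ => ((hasFDerivAt_apply (𝕜 := ℝ) i x).const_sub (y j))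
    have h2 := h.const_mul (- (nodD y j)⁻¹)
    have h3 : (fun x : Fin (n + 1) → ℝ => fL y x j.succ) =
        fun x => - (nodD y j)⁻¹ * ∏ i, (y j - x i) := by
      funext x; simp [fL, fQ]; ring
    rw [h3]
    refine h2.congr_fderiv ?_
    ext1 v
    simp [toCLM_apply, matL, nodE_eval, Finset.mul_sum, mul_assoc]

lemma hasFDerivAt_fR {n : ℕ} (x : Fin (n + 1) → ℝ) (v : Fin (n + 1) → ℝ) :
    HasFDerivAt (fR x) (toCLM (matR x (v 0) (fun i => v i.succ))) v := by
  rw [hasFDerivAt_pi']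
  intro r
  have h : HasFDerivAt (fun v : Fin (n + 1) → ℝ => ∏ i : Fin n, (x r - v i.succ)) _ v :=
      HasFDerivAt.finsetProd (u := univ) (g := fun (i : Fin n) (v : Fin (n + 1) → ℝ) => x r - v i.succ)
        fun (i : Fin n) _ => ((hasFDerivAt_apply (𝕜 := ℝ) i.succ v).const_sub (x r))
  have h2 := ((hasFDerivAt_apply (𝕜 := ℝ) (0 : Fin (n + 1)) v).mul h).const_mul ((nodD x r)⁻¹)
  have h3 : (fun v : Fin (n + 1) → ℝ => fR x v r) =
        fun v => (nodD x r)⁻¹ * (v 0 * ∏ i : Fin n, (x r - v i.succ)) := by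
      funext x; simp [fR, fW]; ring
  rw [h3]
  refine h2.congr_fderiv ?_
  ext1 w
  simp [toCLM_apply, matR, nodE_eval, nod_eval, Fin.sum_univ_succ, Finset.mul_sum, mul_assoc]
  ring

def matA {n : ℕ} (y : Fin n → ℝ) : Matrix (Fin (n + 1)) (Fin (n + 1)) ℝ :=
  Matrix.of fun r m => Fin.cases (motive := fun _ => ℝ) (if m = Fin.last n then 1 else 0)
    (fun j => y j ^ (m : ℕ)) r

lemma vdm_eq_det {n : ℕ} (x : Fin n → ℝ) : vdm x = (Matrix.vandermonde x).det := by
  rw [Matrix.det_vandermonde]; rfl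

lemma abs_det_matA {n : ℕ} (y : Fin n → ℝ) : |(matA y).det| = |vdm y| := by
  rw [Matrix.det_succ_row_zero, Finset.sum_eq_single (Fin.last n)]
  · rw [vdm_eq_det]
    have : (matA y).submatrix Fin.succ (Fin.last n).succAbove = Matrix.vandermonde y := by
      ext i j
      simp [matA, Matrix.vandermonde]
    rw [this]
    simp [matA, abs_mul]
  · intro j _ hj
    simp [matA, hj]
  · simp

lemma eval_fin {n : ℕ} {p : ℝ[X]} (h : p.natDegree < n) (t : ℝ) :
    ∑ m : Fin n, t ^ (m : ℕ) * p.coeff m = p.eval t := by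
  rw [eval_eq_sum_range' h, Finset.sum_range]
  exact Finset.sum_congr rfl fun i _ => mul_comm _ _

lemma vand_mul {n m : ℕ} (x : Fin n → ℝ) (p : Fin m → ℝ[X]) (hp : ∀ k, (p k).natDegree < n) :
    (Matrix.vandermonde x) * (Matrix.of fun (i : Fin n) k => (p k).coeff i) =
      Matrix.of fun r k => (p k).eval (x r) := by
  ext r k
  simp [Matrix.mul_apply, Matrix.vandermonde, eval_fin (hp k)]

lemma matA_mul {n m : ℕ} (y : Fin n → ℝ) (p : Fin m → ℝ[X]) (hp : ∀ k, (p k).natDegree < n + 1) :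
    (matA y) * (Matrix.of fun (i : Fin (n + 1)) k => (p k).coeff i) =
      Matrix.of fun r k => Fin.cases (motive := fun _ => ℝ) ((p k).coeff n)
        (fun j => (p k).eval (y j)) r := by
  ext r k
  refine Fin.cases ?_ (fun j => ?_) r
  · simp [Matrix.mul_apply, matA]
  · simp [Matrix.mul_apply, matA, eval_fin (hp k)]

lemma abs_prod_nodD {n : ℕ} (x : Fin n → ℝ) : |∏ k, nodD x k| = |vdm x| ^ 2 := by
  have h1 : ∀ k, |nodD x k| = (∏ i ∈ Finset.Ioi k, |x i - x k|) * ∏ i ∈ Finset.Iio k, |x k - x i| := by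
    intro k
    rw [nodD, Finset.abs_prod]
    have : univ.erase k = Finset.Ioi k ∪ Finset.Iio k := by
      ext i
      simp only [mem_erase, mem_univ, and_true, mem_union, mem_Ioi, mem_Iio]
      constructor
      · intro h; exact (lt_or_gt_of_ne h).symm
      · rintro (h | h)
        · exact h.ne'
        · exact h.ne
    rw [this, Finset.prod_union]
    · congr 1
      exact Finset.prod_congr rfl fun i _ => abs_sub_comm _ _
    · rw [Finset.disjoint_left]
      intro i h1 h2
      simp at h1 h2
      exact absurd h1 (not_lt.2 h2.le)
  rw [Finset.abs_prod, Finset.prod_congr rfl fun k _ => h1 k, Finset.prod_mul_distrib, pow_two]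
  have h2 : |vdm x| = ∏ k, ∏ i ∈ Finset.Ioi k, |x i - x k| := by
    simp [vdm, Finset.abs_prod]
  rw [h2]
  congr 1
  refine Finset.prod_comm' ?_
  intro a b; simp

lemma vdm_ne {n : ℕ} {x : Fin n → ℝ} (hx : Function.Injective x) : vdm x ≠ 0 := by
  rw [vdm_eq_det]; exact Matrix.det_vandermonde_ne_zero_iff.2 hx

lemma abs_det_matL {n : ℕ} {y : Fin n → ℝ} {x : Fin (n + 1) → ℝ} (hy : Function.Injective y)
    (hx : Function.Injective x) : |(matL y x).det| = |vdm x| / |vdm y| := by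
  set Cx : Matrix (Fin (n + 1)) (Fin (n + 1)) ℝ := Matrix.of fun i k => (nodE x k).coeff i with hC
  have hdeg : ∀ k, (nodE x k).natDegree < n + 1 := fun k => by rw [nodE_natDegree]; omega
  have h1 : matL y x = Matrix.diagonal (Fin.cases (motive := fun _ => ℝ) 1 fun j => (nodD y j)⁻¹) *
      (matA y * Cx) := by
    rw [hC, matA_mul y _ hdeg]
    ext r k
    rw [Matrix.diagonal_mul]
    refine Fin.cases ?_ (fun j => ?_) r
    · simp [matL, nodE_coeff_top]
    · simp [matL]
  have h2 : Matrix.vandermonde x * Cx = Matrix.diagonal (nodD x) := by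
    rw [hC, vand_mul x _ hdeg]
    ext r k
    by_cases h : r = k
    · subst h; simp [nodE_eval_self]
    · simp [h, nodE_eval_ne x k r h]
  have h3 : |vdm x| * |Cx.det| = |vdm x| ^ 2 := by
    rw [← abs_prod_nodD, ← Matrix.det_diagonal, ← h2, Matrix.det_mul, abs_mul, vdm_eq_det]
  have hx0 : |vdm x| ≠ 0 := abs_ne_zero.2 (vdm_ne hx)
  have hy0 : |vdm y| ≠ 0 := abs_ne_zero.2 (vdm_ne hy)
  have h4 : |Cx.det| = |vdm x| := mul_left_cancel₀ hx0 (by rw [h3, pow_two])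
  rw [h1, Matrix.det_mul, Matrix.det_mul, abs_mul, abs_mul, abs_det_matA, h4, Matrix.det_diagonal,
    Fin.prod_univ_succ]
  simp only [Fin.cases_zero, Fin.cases_succ, one_mul]
  rw [Finset.prod_inv_distrib, abs_inv, abs_prod_nodD]
  field_simp

lemma abs_det_matR {n : ℕ} {y : Fin n → ℝ} {x : Fin (n + 1) → ℝ} (hy : Function.Injective y)
    (hx : Function.Injective x) {b : ℝ} (hb : 0 < b) :
    |(matR x b y).det| = b ^ n * |vdm y| / |vdm x| := by
  let p : Fin (n + 1) → ℝ[X] := fun k => Fin.cases (motive := fun _ => ℝ[X]) (nod y)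
    (fun j => C (- b) * nodE y j) k
  set By : Matrix (Fin (n + 1)) (Fin (n + 1)) ℝ := Matrix.of fun i k => (p k).coeff i with hB
  have hdeg' : ∀ j, (C (-b) * nodE y j).natDegree < n := fun j => by
    refine lt_of_le_of_lt (natDegree_C_mul_le _ _) ?_
    rw [nodE_natDegree]; have := j.pos; omega
  have hdeg : ∀ k, (p k).natDegree < n + 1 := fun k => by
    refine Fin.cases ?_ (fun j => ?_) k
    · simp [p, nod_natDegree]
    · exact (hdeg' j).trans (Nat.lt_succ_self n)
  have h1 : matR x b y = Matrix.diagonal (fun r => (nodD x r)⁻¹) * (Matrix.vandermonde x * By) := by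
    rw [hB, vand_mul x _ hdeg]
    ext r k
    rw [Matrix.diagonal_mul]
    refine Fin.cases ?_ (fun j => ?_) k
    · simp [matR, p]
    · simp [matR, p]
  have h2 : matA y * By =
      Matrix.diagonal (Fin.cases (motive := fun _ => ℝ) 1 fun j => - b * nodD y j) := by
    rw [hB, matA_mul y _ hdeg]
    ext r k
    refine Fin.cases ?_ (fun j => ?_) r
    · refine Fin.cases ?_ (fun i => ?_) k
      · simp [p, nod_coeff_top]
      · have := coeff_eq_zero_of_natDegree_lt (hdeg' i)
        rw [Matrix.diagonal_apply_ne _ (Fin.succ_ne_zero i).symm]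
        simpa [p] using this
    · refine Fin.cases ?_ (fun i => ?_) k
      · rw [Matrix.diagonal_apply_ne _ (Fin.succ_ne_zero j)]
        simp [p, nod_eval_self]
      · by_cases h : j = i
        · subst h; simp [p, nodE_eval_self]
        · rw [Matrix.diagonal_apply_ne _ (by simpa using h)]
          simp [p, nodE_eval_ne y i j h]
  have hx0 : |vdm x| ≠ 0 := abs_ne_zero.2 (vdm_ne hx)
  have hy0 : |vdm y| ≠ 0 := abs_ne_zero.2 (vdm_ne hy)
  have h3 : |vdm y| * |By.det| = b ^ n * |vdm y| ^ 2 := by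
    rw [← abs_prod_nodD, ← abs_det_matA, ← abs_mul, ← Matrix.det_mul, h2, Matrix.det_diagonal,
      Fin.prod_univ_succ]
    simp only [Fin.cases_zero, Fin.cases_succ, one_mul]
    rw [Finset.prod_mul_distrib, abs_mul]
    simp [abs_of_pos hb]
  have h4 : |By.det| = b ^ n * |vdm y| := mul_left_cancel₀ hy0 (by rw [h3]; ring)
  rw [h1, Matrix.det_mul, Matrix.det_mul, abs_mul, abs_mul, ← vdm_eq_det, h4, Matrix.det_diagonal,
    Finset.prod_inv_distrib, abs_inv, abs_prod_nodD]
  field_simp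

lemma rev_coeff {m : ℕ} (x : Fin m → ℝ) :
    (∏ i, (1 - C (x i) * X)).coeff 0 = 1 ∧ (∏ i, (1 - C (x i) * X)).coeff 1 = - ∑ i, x i ∧
    (∏ i, (1 - C (x i) * X)).coeff 2 = ((∑ i, x i) ^ 2 - ∑ i, x i ^ 2) / 2 := by
  induction m with
  | zero => simp [coeff_one]
  | succ m ih =>
    obtain ⟨h0, h1, h2⟩ := ih (fun i => x i.succ)
    simp only [Fin.prod_univ_succ, Fin.sum_univ_succ, sub_mul, one_mul, mul_assoc, coeff_sub,
      coeff_C_mul]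
    set P := ∏ i : Fin m, (1 - C (x i.succ) * X) with hP
    have e1 : (X * P).coeff 1 = P.coeff 0 := coeff_X_mul P 0
    have e2 : (X * P).coeff 2 = P.coeff 1 := coeff_X_mul P 1
    have e0 : (X * P).coeff 0 = 0 := by simp
    rw [e0, e1, e2, h0, h1, h2]
    refine ⟨by ring, by ring, by ring⟩

lemma sum_sq_rel {n : ℕ} {y : Fin n → ℝ} (hy : Function.Injective y) (x : Fin (n + 1) → ℝ) :
    ∑ i, x i ^ 2 = ∑ j, y j ^ 2 + fA y x ^ 2 + 2 * ∑ j, fQ y x j := by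
  have key : (∏ i, (1 - C (x i) * X)) = (1 - C (fA y x) * X) * (∏ j, (1 - C (y j) * X))
      - X ^ 2 * ∑ j, C (fQ y x j) * ∏ i ∈ univ.erase j, (1 - C (y i) * X) := by
    apply Polynomial.funext
    intro t
    simp only [eval_sub, eval_mul, eval_prod, eval_one, eval_C, eval_X, eval_pow, eval_finsetSum]
    by_cases ht : t = 0
    · subst ht; simp
    have h := congrArg (fun p => t ^ (n + 1) * eval t⁻¹ p) (relA hy x)
    simp only [eval_sub, eval_mul, eval_C, eval_X, eval_finsetSum, nod_eval, nodE_eval] at h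
    have c1 : ∀ {m : ℕ} (s : Finset (Fin m)) (u : Fin m → ℝ),
        ∏ i ∈ s, (1 - u i * t) = t ^ s.card * ∏ i ∈ s, (t⁻¹ - u i) := by
      intro m s u
      rw [← Finset.prod_const, ← Finset.prod_mul_distrib]
      refine Finset.prod_congr rfl fun i _ => ?_
      field_simp
    rw [c1, c1, Finset.card_univ, Finset.card_univ, Fintype.card_fin, Fintype.card_fin, h, mul_sub]
    congr 1
    · have e : t * t⁻¹ = 1 := mul_inv_cancel₀ ht
      rw [pow_succ]
      linear_combination (t ^ n * ∏ i, (t⁻¹ - y i)) * e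
    · rw [Finset.mul_sum, Finset.mul_sum]
      refine Finset.sum_congr rfl fun j _ => ?_
      rw [c1, Finset.card_erase_of_mem (mem_univ j), Finset.card_univ, Fintype.card_fin]
      have : t ^ (n + 1) = t ^ 2 * t ^ (n - 1) := by
        rw [← pow_add]; congr 1; have := j.pos; omega
      rw [this]; ring
  have h2 := congrArg (fun p => coeff p 2) key
  obtain ⟨y0, y1, y2⟩ := rev_coeff y
  set P := ∏ i : Fin n, (1 - C (y i) * X) with hP
  have e2 : (X * P).coeff 2 = P.coeff 1 := coeff_X_mul P 1
  have e3 : ∀ Q : ℝ[X], (X ^ 2 * Q).coeff 2 = Q.coeff 0 := fun Q => by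
    simpa using coeff_X_pow_mul Q 2 0
  simp only [sub_mul, one_mul, mul_assoc, coeff_sub, coeff_C_mul, e2, e3, (rev_coeff x).2.2, y1, y2,
    finsetSum_coeff] at h2
  have e4 : ∀ j, (∏ i ∈ univ.erase j, (1 - C (y i) * X)).coeff 0 = 1 := fun j => by
    rw [coeff_zero_eq_eval_zero, eval_prod]; simp
  simp only [e4, mul_one] at h2
  have hA : fA y x = ∑ i, x i - ∑ j, y j := rfl
  rw [hA] at h2 ⊢
  linarith

lemma prod_rel {n : ℕ} {y : Fin n → ℝ} {x : Fin (n + 1) → ℝ} (h : Intl x y) {b : ℝ} (hb : 0 < b) :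
    (∏ j, fW x b y j) * |vdm x| ^ 2 = b ^ (n + 1) * (∏ j, fQ y x j) * |vdm y| ^ 2 := by
  have hx0 : |vdm x| ≠ 0 := abs_ne_zero.2 (vdm_ne (chamber_inj h.left))
  have hy0 : |vdm y| ≠ 0 := abs_ne_zero.2 (vdm_ne (chamber_inj h.right))
  have h1 : ∏ j, fW x b y j = b ^ (n + 1) * |∏ j, ∏ i, (x j - y i)| / |vdm x| ^ 2 := by
    rw [← abs_of_pos (Finset.prod_pos fun j _ => fW_pos h hb j), ← abs_prod_nodD]
    simp only [fW]
    rw [Finset.prod_div_distrib, Finset.prod_mul_distrib, abs_div, abs_mul]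
    simp [abs_of_pos hb]
  have h2 : ∏ j, fQ y x j = |∏ j, ∏ i, (y j - x i)| / |vdm y| ^ 2 := by
    rw [← abs_of_pos (Finset.prod_pos fun j _ => fQ_pos h j), ← abs_prod_nodD]
    simp only [fQ]
    rw [Finset.prod_div_distrib, abs_div]
    simp [Finset.abs_prod]
  have h3 : |∏ j, ∏ i, (x j - y i)| = |∏ j, ∏ i, (y j - x i)| := by
    simp only [Finset.abs_prod]
    rw [Finset.prod_comm]
    exact Finset.prod_congr rfl fun i _ => Finset.prod_congr rfl fun j _ => abs_sub_comm _ _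
  rw [h1, h2, h3]
  field_simp

/-- Unnormalised Gaussian density. -/
def gG (μ σ t : ℝ) : ℝ := Real.exp (-(t - μ) ^ 2 / (2 * σ ^ 2))

/-- Unnormalised Gamma density. -/
def hR (s σ t : ℝ) : ℝ := t ^ (s - 1) * Real.exp (-((σ ^ 2)⁻¹ * t))

lemma gG_pos (μ σ t : ℝ) : 0 < gG μ σ t := Real.exp_pos _

lemma hR_pos {s σ t : ℝ} (ht : 0 < t) : 0 < hR s σ t :=
  mul_pos (Real.rpow_pos_of_pos ht _) (Real.exp_pos _)

lemma dens_id_real {n : ℕ} {y : Fin n → ℝ} {x : Fin (n + 1) → ℝ} (h : Intl x y) {b : ℝ}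
    (hb : 0 < b) (β μ σ : ℝ) (hσ : 0 < σ) :
    (|vdm y| ^ β * ∏ j, gG μ σ (y j)) * (∏ j, hR (β / 2) σ (fQ y x j)) * gG μ σ (fA y x) *
      hR (β / 2 * ((n : ℝ) + 1)) σ b * (|vdm x| / |vdm y|) =
    (|vdm x| ^ β * ∏ j, gG μ σ (x j)) * (∏ j, hR (β / 2) σ (fW x b y j)) *
      (b ^ n * |vdm y| / |vdm x|) := by
  have hx0 : 0 < |vdm x| := abs_pos.2 (vdm_ne (chamber_inj h.left))
  have hy0 : 0 < |vdm y| := abs_pos.2 (vdm_ne (chamber_inj h.right))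
  have hp := prod_rel h hb
  have hQ0 : 0 < ∏ j, fQ y x j := Finset.prod_pos fun j _ => fQ_pos h j
  have hW0 : 0 < ∏ j, fW x b y j := Finset.prod_pos fun j _ => fW_pos h hb j
  have e1 : ∏ j, hR (β / 2) σ (fQ y x j) =
      (∏ j, fQ y x j) ^ (β / 2 - 1) * Real.exp (-((σ ^ 2)⁻¹ * ∑ j, fQ y x j)) := by
    simp only [hR]
    rw [Finset.prod_mul_distrib, ← Real.exp_sum, Real.finsetProd_rpow _ _ fun j _ => (fQ_pos h j).le]
    simp [Finset.mul_sum]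
  have e2 : ∏ j, hR (β / 2) σ (fW x b y j) =
      (∏ j, fW x b y j) ^ (β / 2 - 1) * Real.exp (-((σ ^ 2)⁻¹ * b)) := by
    simp only [hR]
    rw [Finset.prod_mul_distrib, ← Real.exp_sum,
      Real.finsetProd_rpow _ _ fun j _ => (fW_pos h hb j).le]
    congr 2
    rw [Finset.sum_neg_distrib, ← Finset.mul_sum, sum_fW (chamber_inj h.left)]
  have e3 : (∏ j, gG μ σ (x j)) = (∏ j, gG μ σ (y j)) * gG μ σ (fA y x) *
      Real.exp (-((σ ^ 2)⁻¹ * ∑ j, fQ y x j)) := by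
    simp only [gG]
    rw [← Real.exp_sum, ← Real.exp_sum, ← Real.exp_add, ← Real.exp_add]
    congr 1
    rw [← Finset.sum_div, ← Finset.sum_div]
    field_simp
    have hs := sum_sq_rel (chamber_inj h.right) x
    have hA : fA y x = ∑ i, x i - ∑ j, y j := rfl
    simp only [Finset.sum_neg_distrib, sub_sq, Finset.sum_add_distrib, Finset.sum_sub_distrib,
      ← Finset.sum_mul, ← Finset.mul_sum, hs, Finset.sum_const, Finset.card_univ, Fintype.card_fin,
      nsmul_eq_mul]
    rw [hA]
    push_cast
    ring
  have e4 : |vdm y| ^ β * (∏ j, fQ y x j) ^ (β / 2 - 1) * b ^ (β / 2 * ((n : ℝ) + 1) - 1) *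
      (|vdm x| / |vdm y|) = |vdm x| ^ β * (∏ j, fW x b y j) ^ (β / 2 - 1) *
      (b ^ n * |vdm y| / |vdm x|) := by
    have hl := congrArg Real.log hp
    rw [Real.log_mul hW0.ne' (by positivity), Real.log_mul (by positivity) (by positivity),
      Real.log_mul (by positivity) hQ0.ne', Real.log_pow, Real.log_pow, Real.log_pow] at hl
    apply Real.log_injOn_pos
    · exact Set.mem_Ioi.2 (by positivity)
    · exact Set.mem_Ioi.2 (by positivity)
    · rw [Real.log_mul (by positivity) (by positivity), Real.log_mul (by positivity) (by positivity),
        Real.log_mul (by positivity) (by positivity), Real.log_mul (by positivity) (by positivity),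
        Real.log_mul (by positivity) (by positivity), Real.log_div (by positivity) (by positivity),
        Real.log_div (by positivity) (by positivity), Real.log_mul (by positivity) (by positivity),
        Real.log_rpow hy0, Real.log_rpow hx0, Real.log_rpow hQ0, Real.log_rpow hW0,
        Real.log_rpow hb, Real.log_pow]
      push_cast at hl
      linear_combination (-(β / 2 - 1)) * hl
  rw [e1, e2, e3]
  simp only [hR]
  linear_combination ((∏ j, gG μ σ (y j)) * gG μ σ (fA y x) *
      Real.exp (-((σ ^ 2)⁻¹ * ∑ j, fQ y x j)) * Real.exp (-((σ ^ 2)⁻¹ * b))) * e4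

/-- Unnormalised densities with values in `ℝ≥0∞`. -/
def gE (μ σ t : ℝ) : ℝ≥0∞ := ENNReal.ofReal (gG μ σ t)

def hE (s σ t : ℝ) : ℝ≥0∞ := if 0 < t then ENNReal.ofReal (hR s σ t) else 0

def wE (n : ℕ) (β μ σ : ℝ) (x : Fin n → ℝ) : ℝ≥0∞ :=
  ENNReal.ofReal ((chamber n).indicator (fun x => |vdm x| ^ β * ∏ j, gG μ σ (x j)) x)

lemma hE_of_pos {s σ t : ℝ} (ht : 0 < t) : hE s σ t = ENNReal.ofReal (hR s σ t) := if_pos ht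

lemma wE_of_mem {n : ℕ} {β μ σ : ℝ} {x : Fin n → ℝ} (hx : x ∈ chamber n) :
    wE n β μ σ x = ENNReal.ofReal (|vdm x| ^ β * ∏ j, gG μ σ (x j)) := by
  rw [wE, Set.indicator_of_mem hx]

lemma wE_of_notMem {n : ℕ} {β μ σ : ℝ} {x : Fin n → ℝ} (hx : x ∉ chamber n) :
    wE n β μ σ x = 0 := by
  rw [wE, Set.indicator_of_notMem hx, ENNReal.ofReal_zero]

lemma dens_id {n : ℕ} {y : Fin n → ℝ} {x : Fin (n + 1) → ℝ} (h : Intl x y) {b : ℝ}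
    (hb : 0 < b) (β μ σ : ℝ) (hσ : 0 < σ) :
    wE n β μ σ y * (∏ j, hE (β / 2) σ (fQ y x j)) * gE μ σ (fA y x) *
      hE (β / 2 * ((n : ℝ) + 1)) σ b * ENNReal.ofReal |(toCLM (matL y x)).det| =
    wE (n + 1) β μ σ x * (∏ j, hE (β / 2) σ (fW x b y j)) *
      ENNReal.ofReal |(toCLM (matR x b y)).det| := by
  have hxi := chamber_inj h.left
  have hyi := chamber_inj h.right
  have p1 : ∀ j, 0 ≤ hR (β / 2) σ (fQ y x j) := fun j => (hR_pos (fQ_pos h j)).le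
  have p2 : ∀ j, 0 ≤ hR (β / 2) σ (fW x b y j) := fun j => (hR_pos (fW_pos h hb j)).le
  have p3 : ∀ t, 0 ≤ gG μ σ t := fun t => (gG_pos μ σ t).le
  rw [toCLM_det, toCLM_det, abs_det_matL hyi hxi, abs_det_matR hyi hxi hb,
    wE_of_mem h.left, wE_of_mem h.right, hE_of_pos hb, gE,
    Finset.prod_congr rfl fun j _ => hE_of_pos (fQ_pos h j),
    Finset.prod_congr rfl fun j _ => hE_of_pos (fW_pos h hb j),
    ← ENNReal.ofReal_prod_of_nonneg fun j _ => p1 j, ← ENNReal.ofReal_prod_of_nonneg fun j _ => p2 j]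
  have q1 := Finset.prod_nonneg fun j (_ : j ∈ univ) => p1 j
  have q2 := Finset.prod_nonneg fun j (_ : j ∈ univ) => p2 j
  have q3 : ∀ {m : ℕ} (u : Fin m → ℝ), 0 ≤ ∏ j, gG μ σ (u j) :=
    fun u => Finset.prod_nonneg fun j _ => p3 _
  have q4 := q3 x
  have q5 := q3 y
  have q6 := p3 (fA y x)
  have q7 : 0 ≤ hR (β / 2 * ((n : ℝ) + 1)) σ b := (hR_pos hb).le
  rw [← ENNReal.ofReal_mul (by positivity), ← ENNReal.ofReal_mul (by positivity),
    ← ENNReal.ofReal_mul (by positivity), ← ENNReal.ofReal_mul (by positivity),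
    ← ENNReal.ofReal_mul (by positivity), ← ENNReal.ofReal_mul (by positivity),
    dens_id_real h hb β μ σ hσ]

/-- The values of the polynomial `nod x` at the points `0, 1, …, n - 1`. -/
def evs {n : ℕ} (x : Fin n → ℝ) : Fin n → ℝ := fun k => (nod x).eval ((k : ℕ) : ℝ)

lemma evs_inj (n : ℕ) : Set.InjOn (evs (n := n)) (chamber n) := by
  intro x hx x' hx' h
  apply nod_inj hx hx'
  have hinj : Function.Injective (fun k : Fin n => ((k : ℕ) : ℝ)) := fun i j hij => by
    exact Fin.ext (Nat.cast_injective hij)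
  refine eq_of_degree_sub_lt_of_eval_index_eq (s := univ) (v := fun k : Fin n => ((k : ℕ) : ℝ))
    hinj.injOn ?_ fun i _ => congrFun h i
  simp only [card_univ, Fintype.card_fin]
  have := degree_sub_lt_left (p := nod x) (q := nod x') (by rw [nod_degree, nod_degree])
    (nod_monic x).ne_zero (by rw [(nod_monic x).leadingCoeff, (nod_monic x').leadingCoeff])
  rwa [nod_degree] at this

lemma chamber_measurable (n : ℕ) : MeasurableSet (chamber n) := by
  have : chamber n = ⋂ i : Fin n, ⋂ j : Fin n, {x | i < j → x j < x i} := by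
    ext x; simp [chamber]
  rw [this]
  refine MeasurableSet.iInter fun i => MeasurableSet.iInter fun j => ?_
  by_cases hij : i < j
  · simp only [hij, true_imp_iff]
    exact measurableSet_lt (measurable_pi_apply j) (measurable_pi_apply i)
  · simp [hij]

lemma evs_continuous (n : ℕ) : Continuous (evs (n := n)) := by
  unfold evs
  simp only [nod_eval]
  fun_prop

lemma exists_Rt (n : ℕ) : ∃ R : (Fin n → ℝ) → (Fin n → ℝ), Measurable R ∧
    ∀ x ∈ chamber n, R (evs x) = x := by
  have h := ContinuousOn.measurableEmbedding (chamber_measurable n)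
    (evs_continuous n).continuousOn (evs_inj n)
  obtain ⟨R, hR, hR2⟩ := h.exists_measurable_extend (g := fun x : chamber n => (x : Fin n → ℝ))
    measurable_subtype_coe (fun _ => inferInstance)
  exact ⟨R, hR, fun x hx => congrFun hR2 ⟨x, hx⟩⟩

/-- A measurable recovery of the ordered roots from the polynomial. -/
def Rt (n : ℕ) : (Fin n → ℝ) → (Fin n → ℝ) := (exists_Rt n).choose

lemma Rt_meas (n : ℕ) : Measurable (Rt n) := (exists_Rt n).choose_spec.1

lemma Rt_evs {n : ℕ} {x : Fin n → ℝ} (hx : x ∈ chamber n) : Rt n (evs x) = x :=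
  (exists_Rt n).choose_spec.2 x hx

/-- The recursion for the characteristic polynomial and the numerator polynomial. -/
def PN : (n : ℕ) → (Fin n → ℝ) → (Fin n → ℝ) → ℝ[X] × ℝ[X]
  | 0, _, _ => (1, 0)
  | n + 1, a, b =>
    ((X - C (a 0)) * (PN n (fun i => a i.succ) (fun i => b i.succ)).1 -
      (PN n (fun i => a i.succ) (fun i => b i.succ)).2,
     C (b 0) * (PN n (fun i => a i.succ) (fun i => b i.succ)).1)

lemma PN_meas (n : ℕ) (t : ℝ) :
    Measurable (fun p : (Fin n → ℝ) × (Fin n → ℝ) => (PN n p.1 p.2).1.eval t) ∧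
    Measurable (fun p : (Fin n → ℝ) × (Fin n → ℝ) => (PN n p.1 p.2).2.eval t) := by
  induction n with
  | zero => simp [PN]
  | succ n ih =>
    have hT : Measurable (fun p : (Fin (n + 1) → ℝ) × (Fin (n + 1) → ℝ) =>
        ((fun i : Fin n => p.1 i.succ, fun i : Fin n => p.2 i.succ) :
          (Fin n → ℝ) × (Fin n → ℝ))) := by fun_prop
    have h1 := ih.1.comp hT
    have h2 := ih.2.comp hT
    simp only [Function.comp_def] at h1 h2
    simp only [PN, eval_sub, eval_mul, eval_X, eval_C]
    exact ⟨by fun_prop, by fun_prop⟩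

/-- Jacobi data and spectral data are related. -/
def SpRel {n : ℕ} (a b x q : Fin n → ℝ) : Prop :=
  (PN n a b).1 = nod x ∧ (PN n a b).2 = ∑ j, C (q j) * nodE x j

/-- One step of the recursion on the level of the spectral data. -/
def stepX {n : ℕ} (y q : Fin n → ℝ) (a : ℝ) : Fin (n + 1) → ℝ :=
  Rt (n + 1) (fun k => (((k : ℕ) : ℝ) - a) * ∏ i, (((k : ℕ) : ℝ) - y i) -
    ∑ j, q j * ∏ i ∈ univ.erase j, (((k : ℕ) : ℝ) - y i))

lemma stepX_eq {n : ℕ} {y q : Fin n → ℝ} {a : ℝ} {x : Fin (n + 1) → ℝ} (hx : x ∈ chamber (n + 1))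
    (h : nod x = (X - C a) * nod y - ∑ j, C (q j) * nodE y j) : stepX y q a = x := by
  rw [stepX]
  conv_rhs => rw [← Rt_evs hx]
  congr 1
  funext k
  rw [evs, h]
  simp only [eval_sub, eval_mul, eval_X, eval_C, eval_finsetSum, nod_eval, nodE_eval]

lemma stepX_spec {n : ℕ} {y : Fin n → ℝ} {x : Fin (n + 1) → ℝ} (h : Intl x y) :
    stepX y (fQ y x) (fA y x) = x :=
  stepX_eq h.left (relA (chamber_inj h.right) x)

lemma stepX_Intl {n : ℕ} {y q : Fin n → ℝ} (hy : y ∈ chamber n) (a : ℝ) (hq : ∀ j, 0 < q j) :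
    Intl (stepX y q a) y ∧
      nod (stepX y q a) = (X - C a) * nod y - ∑ j, C (q j) * nodE y j := by
  obtain ⟨x, hx, -, -, hn⟩ := surjA hy a hq
  rw [stepX_eq hx.left hn]
  exact ⟨hx, hn⟩

lemma stepX_meas (n : ℕ) : Measurable (fun p : ((Fin n → ℝ) × (Fin n → ℝ)) × ℝ =>
    stepX p.1.1 p.1.2 p.2) := by
  unfold stepX
  refine (Rt_meas _).comp ?_
  refine measurable_pi_lambda _ fun k => ?_
  fun_prop

lemma step_rel {n : ℕ} {a b : Fin (n + 1) → ℝ} {y q : Fin n → ℝ} (hy : y ∈ chamber n)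
    (hq : ∀ j, 0 < q j) (hb : 0 < b 0)
    (h : SpRel (fun i => a i.succ) (fun i => b i.succ) y q) :
    SpRel a b (stepX y q (a 0)) (fW (stepX y q (a 0)) (b 0) y) ∧
      stepX y q (a 0) ∈ chamber (n + 1) ∧ ∀ j, 0 < fW (stepX y q (a 0)) (b 0) y j := by
  obtain ⟨h1, h2⟩ := stepX_Intl hy (a 0) hq
  refine ⟨⟨?_, ?_⟩, h1.left, fun j => fW_pos h1 hb j⟩
  · rw [h2, PN, h.1, h.2]
  · rw [← relW (chamber_inj h1.left), PN, h.1]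

lemma exists_rel {n : ℕ} (a b : Fin n → ℝ) (hb : ∀ i, 0 < b i) :
    ∃ x q : Fin n → ℝ, x ∈ chamber n ∧ (∀ j, 0 < q j) ∧ SpRel a b x q := by
  induction n with
  | zero =>
    refine ⟨0, 0, fun i => i.elim0, fun j => j.elim0, ?_, ?_⟩ <;> simp [PN, nod]
  | succ n ih =>
    obtain ⟨y, q, hy, hq, h⟩ := ih (fun i => a i.succ) (fun i => b i.succ) (fun i => hb _)
    obtain ⟨h1, h2, h3⟩ := step_rel hy hq (hb 0) h
    exact ⟨_, _, h2, h3, h1⟩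

@[fun_prop]
lemma gE_meas (μ σ : ℝ) : Measurable (gE μ σ) := by
  unfold gE gG
  fun_prop

@[fun_prop]
lemma hE_meas (s σ : ℝ) : Measurable (hE s σ) := by
  unfold hE hR
  refine Measurable.ite measurableSet_Ioi ?_ measurable_const
  fun_prop

@[fun_prop]
lemma vdm_meas (n : ℕ) : Measurable (vdm (N := n)) := by
  unfold vdm
  fun_prop

@[fun_prop]
lemma wE_meas (n : ℕ) (β μ σ : ℝ) : Measurable (wE n β μ σ) := by
  unfold wE gG
  refine ENNReal.measurable_ofReal.comp (Measurable.indicator ?_ (chamber_measurable n))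
  fun_prop

@[fun_prop]
lemma Measurable.stepX' {α : Type*} [MeasurableSpace α] {n : ℕ} {y q : α → Fin n → ℝ} {a : α → ℝ}
    (hy : Measurable y) (hq : Measurable q) (ha : Measurable a) :
    Measurable (fun z => stepX (y z) (q z) (a z)) :=
  (stepX_meas n).comp ((hy.prodMk hq).prodMk ha)

@[fun_prop]
lemma Measurable.fW' {α : Type*} [MeasurableSpace α] {n : ℕ} {x : α → Fin (n + 1) → ℝ} {b : α → ℝ}
    {y : α → Fin n → ℝ} (hx : Measurable x) (hb : Measurable b) (hy : Measurable y) :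
    Measurable (fun z => fW (x z) (b z) (y z)) := by
  refine measurable_pi_lambda _ fun j => ?_
  unfold fW nodD
  fun_prop

lemma intl_meas (n : ℕ) : MeasurableSet {p : (Fin (n + 1) → ℝ) × (Fin n → ℝ) | Intl p.1 p.2} := by
  have : {p : (Fin (n + 1) → ℝ) × (Fin n → ℝ) | Intl p.1 p.2} =
      ⋂ j : Fin n, ({p | p.2 j < p.1 j.castSucc} ∩ {p | p.1 j.succ < p.2 j}) := by
    ext p; simp [Intl]
  rw [this]
  refine MeasurableSet.iInter fun j => MeasurableSet.inter ?_ ?_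
  · exact measurableSet_lt (by fun_prop) (by fun_prop)
  · exact measurableSet_lt (by fun_prop) (by fun_prop)

/-- Tonelli for the first coordinate. -/
lemma pi_split {n : ℕ} (μ : Fin (n + 1) → Measure ℝ) [∀ i, SigmaFinite (μ i)]
    {f : (Fin (n + 1) → ℝ) → ℝ≥0∞} (hf : Measurable f) :
    ∫⁻ v, f v ∂(Measure.pi μ) =
      ∫⁻ t, ∫⁻ w, f (Fin.cons t w) ∂(Measure.pi fun j : Fin n => μ j.succ) ∂(μ 0) := by
  have h := (measurePreserving_piFinSuccAbove μ 0).symm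
  rw [← h.map_eq, lintegral_map hf (MeasurableEquiv.measurable _), lintegral_prod]
  · have e : ∀ (x : ℝ) (y : Fin n → ℝ),
        (MeasurableEquiv.piFinSuccAbove (fun _ : Fin (n + 1) => ℝ) 0).symm (x, y) =
          Fin.cons x y := fun x y => Fin.insertNth_zero' x y
    simp only [e, Fin.succAbove_zero]
  · exact (hf.comp (MeasurableEquiv.measurable _)).aemeasurable

lemma vol_split {n : ℕ} {f : (Fin (n + 1) → ℝ) → ℝ≥0∞} (hf : Measurable f) :
    ∫⁻ v, f v = ∫⁻ t, ∫⁻ w, f (Fin.cons t w) :=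
  pi_split (fun _ => volume) hf

lemma cvL {n : ℕ} {y : Fin n → ℝ} (hy : y ∈ chamber n) {K : (Fin (n + 1) → ℝ) → ℝ≥0∞}
    (hK : ∀ v, K v ≠ 0 → ∀ j : Fin n, 0 < v j.succ) :
    ∫⁻ v, K v = ∫⁻ x, {x | Intl x y}.indicator
      (fun x => ENNReal.ofReal |(toCLM (matL y x)).det| * K (fL y x)) x := by
  have hS : MeasurableSet {x : Fin (n + 1) → ℝ | Intl x y} :=
    (intl_meas n).preimage (f := fun x => (x, y)) (by fun_prop)
  have himg : fL y '' {x | Intl x y} = {v | ∀ j : Fin n, 0 < v j.succ} := by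
    ext v
    constructor
    · rintro ⟨x, hx, rfl⟩ j
      simpa [fL] using fQ_pos hx j
    · intro hv
      obtain ⟨x, hx, h1, h2, -⟩ := surjA hy (v 0) hv
      refine ⟨x, hx, ?_⟩
      rw [fL, h1, h2]
      exact Fin.cons_self_tail v
  rw [lintegral_indicator hS, ← lintegral_image_eq_lintegral_abs_det_fderiv_mul volume hS
    (fun x _ => (hasFDerivAt_fL y x).hasFDerivWithinAt) _ K, himg]
  · symm
    refine setLIntegral_eq_of_support_subset ?_
    exact fun v hv => hK v hv
  · intro x hx x' hx' h
    simp only [fL] at h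
    have h0 := congrFun h 0
    have h1 := fun j : Fin n => congrFun h j.succ
    simp only [Fin.cons_zero, Fin.cons_succ] at h0 h1
    exact injA hx hx' h0 (funext h1)

lemma cvR {n : ℕ} {x : Fin (n + 1) → ℝ} (hx : x ∈ chamber (n + 1)) {K : (Fin (n + 1) → ℝ) → ℝ≥0∞}
    (hK : ∀ v, K v ≠ 0 → ∀ j, 0 < v j) :
    ∫⁻ v, K v = ∫⁻ v, {v : Fin (n + 1) → ℝ | 0 < v 0 ∧ Intl x (fun i : Fin n => v i.succ)}.indicator
      (fun v => ENNReal.ofReal |(toCLM (matR x (v 0) (fun i => v i.succ))).det| * K (fR x v)) v := by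
  have hS : MeasurableSet {v : Fin (n + 1) → ℝ | 0 < v 0 ∧ Intl x (fun i : Fin n => v i.succ)} := by
    refine MeasurableSet.inter (measurableSet_lt measurable_const (measurable_pi_apply 0)) ?_
    exact (intl_meas n).preimage
      (f := fun v : Fin (n + 1) → ℝ => (x, fun i : Fin n => v i.succ)) (by fun_prop)
  have himg : fR x '' {v : Fin (n + 1) → ℝ | 0 < v 0 ∧ Intl x (fun i : Fin n => v i.succ)} =
      {v | ∀ j, 0 < v j} := by
    ext q
    constructor
    · rintro ⟨v, ⟨h1, h2⟩, rfl⟩ j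
      exact fW_pos h2 h1 j
    · intro hq
      obtain ⟨b, y, hb, h1, h2⟩ := surjW hx hq
      exact ⟨Fin.cons b y, ⟨by simpa using hb, by simpa using h1⟩, by simpa [fR] using h2⟩
  rw [lintegral_indicator hS, ← lintegral_image_eq_lintegral_abs_det_fderiv_mul volume hS
    (fun v _ => (hasFDerivAt_fR x v).hasFDerivWithinAt) _ K, himg]
  · symm
    exact setLIntegral_eq_of_support_subset fun v hv => hK v hv
  · rintro v ⟨h1, h2⟩ v' ⟨h1', h2'⟩ h
    obtain ⟨e1, e2⟩ := injW h2 h2' h1 h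
    rw [← Fin.cons_self_tail v, ← Fin.cons_self_tail v']
    exact congrArg₂ _ e1 e2

lemma swap2 {α β : Type*} [MeasureSpace α] [MeasureSpace β]
    [SFinite (volume : Measure α)] [SFinite (volume : Measure β)]
    {f : α → β → ℝ≥0∞} (hf : Measurable (fun p : α × β => f p.1 p.2)) :
    ∫⁻ a, ∫⁻ b, f a b = ∫⁻ b, ∫⁻ a, f a b :=
  lintegral_lintegral_swap hf.aemeasurable

lemma swap3 {α β γ : Type*} [MeasureSpace α] [MeasureSpace β] [MeasureSpace γ]
    [SFinite (volume : Measure α)] [SFinite (volume : Measure β)] [SFinite (volume : Measure γ)]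
    {f : α → β → γ → ℝ≥0∞} (hf : Measurable (fun p : α × β × γ => f p.1 p.2.1 p.2.2)) :
    ∫⁻ a, ∫⁻ b, ∫⁻ c, f a b c = ∫⁻ c, ∫⁻ a, ∫⁻ b, f a b c := by
  have h1 : ∀ a, ∫⁻ b, ∫⁻ c, f a b c = ∫⁻ c, ∫⁻ b, f a b c := fun a =>
    swap2 (hf.comp (by fun_prop : Measurable fun p : β × γ => (a, p.1, p.2)))
  simp_rw [h1]
  refine swap2 (f := fun a c => ∫⁻ b, f a b c) ?_
  exact Measurable.lintegral_prod_right' (f := fun p : (α × γ) × β => f p.1.1 p.2 p.1.2)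
    (hf.comp (by fun_prop : Measurable fun p : (α × γ) × β => (p.1.1, p.2, p.1.2)))

/-- The product densities. -/
def dA (μ σ : ℝ) {n : ℕ} (a : Fin n → ℝ) : ℝ≥0∞ := ∏ i, gE μ σ (a i)

def dB (β σ : ℝ) {n : ℕ} (b : Fin n → ℝ) : ℝ≥0∞ :=
  ∏ k : Fin n, hE (β / 2 * ((n : ℝ) - ((k : ℕ) : ℝ))) σ (b k)

def dQ (β σ : ℝ) {n : ℕ} (q : Fin n → ℝ) : ℝ≥0∞ := ∏ j, hE (β / 2) σ (q j)

@[fun_prop]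
lemma dA_meas (μ σ : ℝ) (n : ℕ) : Measurable (dA μ σ (n := n)) := by
  unfold dA; fun_prop

@[fun_prop]
lemma dB_meas (β σ : ℝ) (n : ℕ) : Measurable (dB β σ (n := n)) := by
  unfold dB; fun_prop

@[fun_prop]
lemma dQ_meas (β σ : ℝ) (n : ℕ) : Measurable (dQ β σ (n := n)) := by
  unfold dQ; fun_prop

lemma dA_cons (μ σ : ℝ) {n : ℕ} (t : ℝ) (v : Fin n → ℝ) :
    dA μ σ (Fin.cons t v : Fin (n + 1) → ℝ) = gE μ σ t * dA μ σ v := by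
  simp [dA, Fin.prod_univ_succ]

lemma dB_cons (β σ : ℝ) {n : ℕ} (t : ℝ) (v : Fin n → ℝ) :
    dB β σ (Fin.cons t v : Fin (n + 1) → ℝ) = hE (β / 2 * ((n : ℝ) + 1)) σ t * dB β σ v := by
  simp [dB, Fin.prod_univ_succ]

lemma hE_ne {s σ t : ℝ} (h : hE s σ t ≠ 0) : 0 < t := by
  by_contra h1
  exact h (if_neg h1)

lemma dQ_ne {β σ : ℝ} {n : ℕ} {q : Fin n → ℝ} (h : dQ β σ q ≠ 0) (j : Fin n) : 0 < q j :=
  hE_ne (Finset.prod_ne_zero_iff.1 h j (mem_univ j))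

@[fun_prop]
lemma cons_meas {α : Type*} [MeasurableSpace α] {n : ℕ} {t : α → ℝ} {w : α → Fin n → ℝ}
    (ht : Measurable t) (hw : Measurable w) :
    Measurable (fun z => (Fin.cons (t z) (w z) : Fin (n + 1) → ℝ)) := by
  refine measurable_pi_lambda _ fun j => ?_
  refine Fin.cases ?_ (fun i => ?_) j
  · simpa using ht
  · simp only [Fin.cons_succ]; fun_prop

/-- The middle integrand. -/
def midM {n : ℕ} (β μ σ : ℝ) (F : (Fin (n + 1) → ℝ) × (Fin (n + 1) → ℝ) → ℝ≥0∞)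
    (x : Fin (n + 1) → ℝ) (s : ℝ) (y : Fin n → ℝ) : ℝ≥0∞ :=
  {p : ((Fin (n + 1) → ℝ) × (Fin n → ℝ)) × ℝ | Intl p.1.1 p.1.2 ∧ 0 < p.2}.indicator
    (fun p => wE (n + 1) β μ σ p.1.1 * dQ β σ (fW p.1.1 p.2 p.1.2) *
      ENNReal.ofReal (p.2 ^ n * |vdm p.1.2| / |vdm p.1.1|) * F (p.1.1, fW p.1.1 p.2 p.1.2))
    ((x, y), s)

@[fun_prop]
lemma midM_meas {α : Type*} [MeasurableSpace α] {n : ℕ} (β μ σ : ℝ)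
    {F : (Fin (n + 1) → ℝ) × (Fin (n + 1) → ℝ) → ℝ≥0∞}
    (hF : Measurable F) {x : α → Fin (n + 1) → ℝ} {s : α → ℝ} {y : α → Fin n → ℝ}
    (hx : Measurable x) (hs : Measurable s) (hy : Measurable y) :
    Measurable (fun z => midM β μ σ F (x z) (s z) (y z)) := by
  unfold midM
  refine Measurable.comp (g := Set.indicator _ _) (f := fun z => ((x z, y z), s z)) ?_ (by fun_prop)
  refine Measurable.indicator ?_ ?_
  · fun_prop
  · refine MeasurableSet.inter ((intl_meas n).preimage measurable_fst) ?_
    exact measurableSet_lt measurable_const measurable_snd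

lemma left_eq {n : ℕ} {β μ σ : ℝ} (hσ : 0 < σ)
    (F : (Fin (n + 1) → ℝ) × (Fin (n + 1) → ℝ) → ℝ≥0∞) (hF : Measurable F)
    (s : ℝ) (y : Fin n → ℝ) :
    ∫⁻ t, ∫⁻ q : Fin n → ℝ, gE μ σ t * hE (β / 2 * ((n : ℝ) + 1)) σ s *
      (F (stepX y q t, fW (stepX y q t) s y) * wE n β μ σ y * dQ β σ q) =
    ∫⁻ x, midM β μ σ F x s y := by
  by_cases hs : 0 < s
  swap
  · simp [hE, hs, midM]
  by_cases hy : y ∈ chamber n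
  swap
  · have : ∀ x, ¬ Intl x y := fun x h => hy h.right
    simp [wE_of_notMem hy, midM, this]
  have h1 := vol_split (n := n) (f := fun v => gE μ σ (v 0) * hE (β / 2 * ((n : ℝ) + 1)) σ s *
      (F (stepX y (fun i => v i.succ) (v 0), fW (stepX y (fun i => v i.succ) (v 0)) s y) *
        wE n β μ σ y * dQ β σ (fun i => v i.succ))) (by fun_prop)
  simp only [Fin.cons_zero, Fin.cons_succ] at h1
  rw [← h1, cvL hy]
  · refine lintegral_congr fun x => ?_
    by_cases hx : Intl x y
    swap
    · simp [midM, hx]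
    simp only [midM, fL]
    rw [Set.indicator_of_mem (by exact hx), Set.indicator_of_mem (by exact ⟨hx, hs⟩)]
    simp only [Fin.cons_zero, Fin.cons_succ]
    have hst := stepX_spec hx
    have e := dens_id hx hs β μ σ hσ
    rw [toCLM_det (matR _ _ _), abs_det_matR (chamber_inj hx.right) (chamber_inj hx.left) hs] at e
    have e1 : (fun i => fQ y x i) = fQ y x := rfl
    simp only [e1, hst]
    simp only [dQ]
    rw [← e]
    ring
  · intro v hv j
    have := (mul_ne_zero_iff.1 (mul_ne_zero_iff.1 hv).2).2
    exact dQ_ne this j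

lemma right_eq {n : ℕ} {β μ σ : ℝ}
    (F : (Fin (n + 1) → ℝ) × (Fin (n + 1) → ℝ) → ℝ≥0∞) (hF : Measurable F)
    (x : Fin (n + 1) → ℝ) :
    ∫⁻ s, ∫⁻ y, midM β μ σ F x s y =
      ∫⁻ q, F (x, q) * wE (n + 1) β μ σ x * dQ β σ q := by
  by_cases hx : x ∈ chamber (n + 1)
  swap
  · have : ∀ y, ¬ Intl x y := fun y h => hx h.left
    simp [wE_of_notMem hx, midM, this]
  rw [cvR hx]
  · have h1 := vol_split (n := n) (f := fun v => midM β μ σ F x (v 0) (fun i => v i.succ))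
      (by fun_prop)
    simp only [Fin.cons_zero, Fin.cons_succ] at h1
    rw [← h1]
    refine lintegral_congr fun v => ?_
    by_cases hv : 0 < v 0 ∧ Intl x (fun i : Fin n => v i.succ)
    swap
    · have hv2 : ¬ (Intl x (fun i : Fin n => v i.succ) ∧ 0 < v 0) := fun h => hv h.symm
      rw [midM, Set.indicator_of_notMem (by exact hv2), Set.indicator_of_notMem (by exact hv)]
    rw [midM, Set.indicator_of_mem (by exact hv.symm), Set.indicator_of_mem (by exact hv),
      toCLM_det (matR _ _ _), abs_det_matR (chamber_inj hv.2.right) (chamber_inj hv.2.left) hv.1]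
    simp only [fR]
    ring
  · intro q hq j
    exact dQ_ne (mul_ne_zero_iff.1 hq).2 j

/-- The main identity: Jacobi data against spectral data, up to no constant at all. -/
theorem main_S (β μ σ : ℝ) (hσ : 0 < σ) (n : ℕ) :
    ∀ (H F : (Fin n → ℝ) × (Fin n → ℝ) → ℝ≥0∞), Measurable H → Measurable F →
      (∀ a b x q : Fin n → ℝ, (∀ i, 0 < b i) → x ∈ chamber n → (∀ j, 0 < q j) → SpRel a b x q →
        H (a, b) = F (x, q)) →
      ∫⁻ a, ∫⁻ b, H (a, b) * dA μ σ a * dB β σ b =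
        ∫⁻ x, ∫⁻ q, F (x, q) * wE n β μ σ x * dQ β σ q := by
  induction n with
  | zero =>
    intro H F _ _ hHF
    refine lintegral_congr fun a => lintegral_congr fun b => ?_
    have ha : a ∈ chamber 0 := fun i => i.elim0
    rw [hHF a b a b (fun i => i.elim0) ha (fun i => i.elim0)
      ⟨by simp [PN, nod], by simp [PN]⟩, wE_of_mem ha]
    simp [dA, dB, dQ, vdm]
  | succ n ih =>
    intro H F hH hF hHF
    have s1 : ∀ a : Fin (n + 1) → ℝ, ∫⁻ b, H (a, b) * dA μ σ a * dB β σ b =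
        ∫⁻ s, ∫⁻ w, H (a, Fin.cons s w) * dA μ σ a * dB β σ (Fin.cons s w : Fin (n + 1) → ℝ) :=
      fun a => vol_split (f := fun b => H (a, b) * dA μ σ a * dB β σ b) (by fun_prop)
    simp_rw [s1]
    have s2 := vol_split (n := n) (f := fun a => ∫⁻ s, ∫⁻ w, H (a, Fin.cons s w) * dA μ σ a *
        dB β σ (Fin.cons s w : Fin (n + 1) → ℝ)) (by fun_prop)
    rw [s2]
    have s3 : ∀ t : ℝ, ∫⁻ v : Fin n → ℝ, ∫⁻ s, ∫⁻ w, H (Fin.cons t v, Fin.cons s w) *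
          dA μ σ (Fin.cons t v : Fin (n + 1) → ℝ) * dB β σ (Fin.cons s w : Fin (n + 1) → ℝ) =
        ∫⁻ s, ∫⁻ y : Fin n → ℝ, ∫⁻ q : Fin n → ℝ,
          gE μ σ t * hE (β / 2 * ((n : ℝ) + 1)) σ s *
            (F (stepX y q t, fW (stepX y q t) s y) * wE n β μ σ y * dQ β σ q) := by
      intro t
      rw [swap2 (f := fun v s => ∫⁻ w, H (Fin.cons t v, Fin.cons s w) *
          dA μ σ (Fin.cons t v : Fin (n + 1) → ℝ) * dB β σ (Fin.cons s w : Fin (n + 1) → ℝ))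
          (by fun_prop)]
      refine lintegral_congr fun s => ?_
      by_cases hs : 0 < s
      swap
      · have : hE (β / 2 * ((n : ℝ) + 1)) σ s = 0 := if_neg hs
        simp [dB_cons, this]
      have h := ih (fun p => H (Fin.cons t p.1, Fin.cons s p.2))
        (fun p => F (stepX p.1 p.2 t, fW (stepX p.1 p.2 t) s p.1)) (by fun_prop) (by fun_prop) ?_
      · simp only [dA_cons, dB_cons]
        have e1 : ∀ v w : Fin n → ℝ, H (Fin.cons t v, Fin.cons s w) * (gE μ σ t * dA μ σ v) *
            (hE (β / 2 * ((n : ℝ) + 1)) σ s * dB β σ w) =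
            gE μ σ t * hE (β / 2 * ((n : ℝ) + 1)) σ s *
              (H (Fin.cons t v, Fin.cons s w) * dA μ σ v * dB β σ w) := fun v w => by ring
        simp_rw [e1]
        set c := gE μ σ t * hE (β / 2 * ((n : ℝ) + 1)) σ s
        have e2 : ∀ G : (Fin n → ℝ) → (Fin n → ℝ) → ℝ≥0∞,
            Measurable (fun p : (Fin n → ℝ) × (Fin n → ℝ) => G p.1 p.2) →
            ∫⁻ v, ∫⁻ w, c * G v w = c * ∫⁻ v, ∫⁻ w, G v w := by
          intro G hG
          rw [← lintegral_const_mul]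
          · refine lintegral_congr fun v => ?_
            rw [lintegral_const_mul]
            exact hG.comp (by fun_prop : Measurable fun w => (v, w))
          · exact hG.lintegral_prod_right'
        rw [e2 _ (by fun_prop), e2 _ (by fun_prop), h]
      · intro a b y q hb hy hq hr
        obtain ⟨h1, h2, h3⟩ := step_rel (a := Fin.cons t a) (b := Fin.cons s b) hy hq
          (by simpa using hs) (by simpa using hr)
        simp only [Fin.cons_zero] at h1 h2 h3
        refine hHF _ _ _ _ ?_ h2 h3 h1
        intro i
        refine Fin.cases (by simpa using hs) (fun j => by simpa using hb j) i
    simp_rw [s3]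
    rw [swap3 (f := fun t s y => ∫⁻ q : Fin n → ℝ,
          gE μ σ t * hE (β / 2 * ((n : ℝ) + 1)) σ s *
            (F (stepX y q t, fW (stepX y q t) s y) * wE n β μ σ y * dQ β σ q)) (by fun_prop)]
    have s4 : ∀ y : Fin n → ℝ, ∫⁻ t, ∫⁻ s, ∫⁻ q : Fin n → ℝ,
          gE μ σ t * hE (β / 2 * ((n : ℝ) + 1)) σ s *
            (F (stepX y q t, fW (stepX y q t) s y) * wE n β μ σ y * dQ β σ q) =
        ∫⁻ s, ∫⁻ x, midM β μ σ F x s y := by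
      intro y
      rw [swap2 (by fun_prop)]
      exact lintegral_congr fun s => left_eq hσ F hF s y
    simp_rw [s4]
    rw [swap3 (f := fun y s x => midM β μ σ F x s y) (by fun_prop)]
    refine lintegral_congr fun x => ?_
    rw [swap2 (by fun_prop)]
    exact right_eq F hF x

lemma det_tridiag {R : Type*} [CommRing R] {n : ℕ} (A : Matrix (Fin (n + 2)) (Fin (n + 2)) R)
    (h1 : ∀ j : Fin n, A 0 j.succ.succ = 0) (h2 : ∀ j : Fin n, A j.succ.succ 0 = 0) :
    A.det = A 0 0 * (A.submatrix Fin.succ Fin.succ).det -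
      A 0 1 * A 1 0 * (A.submatrix (fun i : Fin n => i.succ.succ) (fun i => i.succ.succ)).det := by
  rw [Matrix.det_succ_row_zero, Fin.sum_univ_succ, Fin.sum_univ_succ, Finset.sum_eq_zero]
  · have e : (A.submatrix Fin.succ (Fin.succAbove (1 : Fin (n + 2)))).det = A 1 0 *
        (A.submatrix (fun i : Fin n => i.succ.succ) (fun i => i.succ.succ)).det := by
      rw [Matrix.det_succ_column_zero, Fin.sum_univ_succ, Finset.sum_eq_zero]
      · simp only [Fin.val_zero, pow_zero, one_mul, Matrix.submatrix_apply, add_zero,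
          Matrix.submatrix_submatrix]
        congr 2
      · intro j _
        have : A j.succ.succ 0 = 0 := h2 j
        simp [this]
    simp only [Fin.succ_zero_eq_one, e]
    simp
    ring
  · intro j _
    rw [h1 j]; ring

/-- Auxiliary tridiagonal matrix with a convenient indexing. -/
def triM {n : ℕ} (a b : Fin n → ℝ) : Matrix (Fin n) (Fin n) ℝ :=
  Matrix.of fun i j =>
    if i = j then a i
    else if (i : ℕ) + 1 = (j : ℕ) then Real.sqrt (b j)
    else if (j : ℕ) + 1 = (i : ℕ) then Real.sqrt (b i)
    else 0

lemma triM_sub {n : ℕ} (a b : Fin (n + 1) → ℝ) :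
    (triM a b).charmatrix.submatrix Fin.succ Fin.succ =
      (triM (fun i => a i.succ) (fun i => b i.succ)).charmatrix := by
  ext1 i j
  simp only [Matrix.submatrix_apply, Matrix.charmatrix_apply, triM, Matrix.of_apply,
    Matrix.diagonal_apply, Fin.succ_inj, Fin.val_succ, Nat.add_right_cancel_iff]

lemma triM_charpoly (n : ℕ) : ∀ a b : Fin n → ℝ, (∀ i, 0 ≤ b i) →
    (triM a b).charpoly = (PN n a b).1 := by
  induction n using Nat.twoStepInduction with
  | zero => intro a b _; simp [PN, Matrix.charpoly]
  | one => intro a b _; simp [PN, Matrix.charpoly, triM]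
  | more n ih1 ih2 =>
    intro a b hb
    have h1 := ih1 (fun i => a i.succ.succ) (fun i => b i.succ.succ) (fun i => hb _)
    have h2 := ih2 (fun i => a i.succ) (fun i => b i.succ) (fun i => hb _)
    rw [PN, ← h2, PN, ← h1]
    simp only [Matrix.charpoly]
    rw [det_tridiag, triM_sub]
    · have e : (triM a b).charmatrix.submatrix (fun i : Fin n => i.succ.succ)
          (fun i => i.succ.succ) =
          (triM (fun i : Fin n => a i.succ.succ) (fun i => b i.succ.succ)).charmatrix := by
        rw [← triM_sub (fun i => a i.succ) (fun i => b i.succ), ← triM_sub]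
        rfl
      rw [e]
      have e0 : (triM a b).charmatrix 0 0 = X - C (a 0) := by
        simp [triM]
      have e1 : (triM a b).charmatrix 0 1 = - C (Real.sqrt (b 1)) := by
        simp [triM]
      have e2 : (triM a b).charmatrix 1 0 = - C (Real.sqrt (b 1)) := by
        simp [triM]
      rw [e0, e1, e2, neg_mul_neg, ← C_mul, Real.mul_self_sqrt (hb 1)]
      rfl
    · intro j
      have h : (0 : Fin (n + 2)) ≠ j.succ.succ := (Fin.succ_ne_zero _).symm
      simp [triM, h]
    · intro j
      have h : j.succ.succ ≠ (0 : Fin (n + 2)) := Fin.succ_ne_zero _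
      simp [triM, h]

lemma jacobi_eq_triM {n : ℕ} (a b : Fin (n + 1) → ℝ) :
    jacobiMatrix (N := n + 1) a (fun i : Fin n => b i.succ) = triM a b := by
  ext i j
  simp only [jacobiMatrix, triM, Matrix.of_apply]
  split_ifs with h1 h2 h3
  · rfl
  · congr 2; exact Fin.ext h2
  · congr 2; exact Fin.ext h3
  · rfl

lemma sortDesc_eq {n : ℕ} {v x : Fin n → ℝ} (hx : x ∈ chamber n) (h : nod v = nod x) :
    sortDesc v = x := by
  have hr : ∀ u : Fin n → ℝ, (nod u).roots = Multiset.map u Finset.univ.val := fun u => by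
    rw [nod, Polynomial.roots_prod]
    · simp
    · simp [Finset.prod_ne_zero_iff, Polynomial.X_sub_C_ne_zero]
  have hm : Multiset.map v Finset.univ.val = Multiset.map x Finset.univ.val := by
    rw [← hr, ← hr, h]
  have hv : Function.Injective v := by
    have h1 : (Multiset.map x Finset.univ.val).Nodup :=
      Multiset.Nodup.map (chamber_inj hx) Finset.univ.nodup
    rw [← hm] at h1
    intro i j hij
    exact Multiset.inj_on_of_nodup_map h1 i (mem_univ i) j (mem_univ j) hij
  refine nod_inj ?_ hx ?_
  · intro i j hij
    have h1 : (v ∘ Tuple.sort v) (Fin.rev j) ≤ (v ∘ Tuple.sort v) (Fin.rev i) :=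
      Tuple.monotone_sort v (Fin.rev_le_rev.2 hij.le)
    refine lt_of_le_of_ne h1 fun h2 => ?_
    have h3 := (Tuple.sort v).injective (hv h2)
    exact hij.ne' (Fin.rev_injective h3)
  · rw [← h]
    unfold nod sortDesc
    exact Equiv.prod_comp (Fin.revPerm.trans (Tuple.sort v)) (fun i => X - C (v i))

lemma jacobiEigs_eq {n : ℕ} {a b x q : Fin (n + 1) → ℝ} (hb : ∀ i, 0 ≤ b i)
    (hx : x ∈ chamber (n + 1)) (h : SpRel a b x q) :
    jacobiEigs (N := n + 1) a (fun i : Fin n => b i.succ) = x := by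
  refine sortDesc_eq hx ?_
  rw [← h.1, ← triM_charpoly _ a b hb, ← jacobi_eq_triM,
    (jacobiMatrix_isHermitian (N := n + 1) a (fun i : Fin n => b i.succ)).charpoly_eq]
  rfl

lemma pi_dens {n : ℕ} (μ : Fin n → Measure ℝ) [∀ i, SigmaFinite (μ i)] (d : Fin n → ℝ → ℝ≥0∞)
    (hd : ∀ i, Measurable (d i)) (h : ∀ i, μ i = volume.withDensity (d i))
    {f : (Fin n → ℝ) → ℝ≥0∞} (hf : Measurable f) :
    ∫⁻ v, f v ∂(Measure.pi μ) = ∫⁻ v, f v * ∏ i, d i (v i) := by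
  induction n with
  | zero =>
    have : μ = fun _ => volume := funext fun i => i.elim0
    subst this
    simp [volume_pi]
  | succ n ih =>
    rw [pi_split μ hf, vol_split (by fun_prop)]
    have e : ∀ t, ∫⁻ w, f (Fin.cons t w) ∂(Measure.pi fun j : Fin n => μ j.succ) =
        ∫⁻ w : Fin n → ℝ, f (Fin.cons t w) * ∏ i, d i.succ (w i) := fun t =>
      ih (fun j => μ j.succ) (fun j => d j.succ) (fun j => hd _) (fun j => h _) (by fun_prop)
    simp_rw [e]
    rw [h 0, lintegral_withDensity_eq_lintegral_mul _ (hd 0) (by fun_prop)]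
    refine lintegral_congr fun t => ?_
    rw [Pi.mul_apply, ← lintegral_const_mul _ (by fun_prop)]
    refine lintegral_congr fun w => ?_
    rw [Fin.prod_univ_succ]
    simp only [Fin.cons_zero, Fin.cons_succ]
    ring

lemma gauss_eq (μ σ : ℝ) (hσ : 0 < σ) : ∃ c : ℝ≥0∞, c ≠ 0 ∧ c ≠ ⊤ ∧
    gaussianReal μ ⟨σ ^ 2, sq_nonneg σ⟩ = volume.withDensity (fun t => c * gE μ σ t) := by
  have hv : (⟨σ ^ 2, sq_nonneg σ⟩ : ℝ≥0) ≠ 0 := by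
    intro h
    have this : σ ^ 2 = 0 := congrArg NNReal.toReal h
    exact hσ.ne' (pow_eq_zero_iff two_ne_zero |>.1 this)
  have hp : 0 < (√(2 * π * σ ^ 2))⁻¹ := by positivity
  refine ⟨ENNReal.ofReal (√(2 * π * σ ^ 2))⁻¹, (ENNReal.ofReal_pos.2 hp).ne', ENNReal.ofReal_ne_top, ?_⟩
  rw [gaussianReal_of_var_ne_zero _ hv]
  refine congrArg (fun d => volume.withDensity d) (funext fun t => ?_)
  rw [gE, gG, ← ENNReal.ofReal_mul hp.le]
  rfl

lemma gamma_eq (s σ : ℝ) (hs : 0 < s) (hσ : 0 < σ) : ∃ c : ℝ≥0∞, c ≠ 0 ∧ c ≠ ⊤ ∧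
    gammaMeasure s (σ ^ 2)⁻¹ = volume.withDensity (fun t => c * hE s σ t) := by
  have hp : 0 < ((σ ^ 2)⁻¹) ^ s / Real.Gamma s := by
    have := Real.Gamma_pos_of_pos hs
    positivity
  refine ⟨ENNReal.ofReal (((σ ^ 2)⁻¹) ^ s / Real.Gamma s), (ENNReal.ofReal_pos.2 hp).ne',
    ENNReal.ofReal_ne_top, ?_⟩
  rw [gammaMeasure]
  refine withDensity_congr_ae ?_
  have h0 : ∀ᵐ t : ℝ, t ≠ 0 := by
    simp [ae_iff]
  filter_upwards [h0] with t ht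
  rw [gammaPDF, gammaPDFReal]
  by_cases h : 0 < t
  · rw [if_pos h.le, hE_of_pos h, hR, ← ENNReal.ofReal_mul hp.le]
    congr 1
    ring
  · have h1 : ¬ 0 ≤ t := fun h2 => h (lt_of_le_of_ne h2 ht.symm)
    rw [if_neg h1, hE, if_neg h]
    simp

lemma hE_int (s σ : ℝ) (hs : 0 < s) (hσ : 0 < σ) :
    ∫⁻ t, hE s σ t ≠ 0 ∧ ∫⁻ t, hE s σ t ≠ ⊤ := by
  obtain ⟨c, hc0, hc1, hc⟩ := gamma_eq s σ hs hσ
  have hp : IsProbabilityMeasure (gammaMeasure s (σ ^ 2)⁻¹) :=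
    isProbabilityMeasure_gammaMeasure hs (by positivity)
  have h1 : gammaMeasure s (σ ^ 2)⁻¹ Set.univ = 1 := measure_univ
  rw [hc, withDensity_apply _ MeasurableSet.univ, Measure.restrict_univ,
    lintegral_const_mul _ (by fun_prop)] at h1
  constructor
  · intro h; simp [h] at h1
  · intro h; rw [h, ENNReal.mul_top hc0] at h1; exact absurd h1 (by simp)

lemma dQ_int (β σ : ℝ) (hβ : 0 < β) (hσ : 0 < σ) (n : ℕ) :
    ∫⁻ q : Fin n → ℝ, dQ β σ q ≠ 0 ∧ ∫⁻ q : Fin n → ℝ, dQ β σ q ≠ ⊤ := by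
  induction n with
  | zero => simp [dQ, volume_pi]
  | succ n ih =>
    rw [vol_split (by fun_prop)]
    have e : ∀ (t : ℝ) (w : Fin n → ℝ), dQ β σ (Fin.cons t w : Fin (n + 1) → ℝ) =
        hE (β / 2) σ t * dQ β σ w := fun t w => by simp [dQ, Fin.prod_univ_succ]
    simp_rw [e]
    have e2 : ∀ t, ∫⁻ w : Fin n → ℝ, hE (β / 2) σ t * dQ β σ w =
        hE (β / 2) σ t * ∫⁻ w : Fin n → ℝ, dQ β σ w := fun t =>
      lintegral_const_mul _ (by fun_prop)
    simp_rw [e2]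
    rw [lintegral_mul_const _ (by fun_prop)]
    have h := hE_int (β / 2) σ (by positivity) hσ
    exact ⟨mul_ne_zero h.1 ih.1, ENNReal.mul_ne_top h.2 ih.2⟩

/-- A measurable version of the eigenvalue map. -/
def eigT {n : ℕ} (a b : Fin (n + 1) → ℝ) : Fin (n + 1) → ℝ :=
  Rt (n + 1) (fun k => (PN (n + 1) a b).1.eval ((k : ℕ) : ℝ))

lemma eigT_meas (n : ℕ) :
    Measurable (fun p : (Fin (n + 1) → ℝ) × (Fin (n + 1) → ℝ) => eigT p.1 p.2) :=
  (Rt_meas _).comp (measurable_pi_lambda _ fun _ => (PN_meas (n + 1) _).1)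

@[fun_prop]
lemma Measurable.eigT' {α : Type*} [MeasurableSpace α] {n : ℕ} {u v : α → Fin (n + 1) → ℝ}
    (hu : Measurable u) (hv : Measurable v) : Measurable (fun z => eigT (u z) (v z)) := by
  have h := (eigT_meas n).comp (hu.prodMk hv)
  simp only [Function.comp_def] at h
  exact h

lemma eigT_eq {n : ℕ} {a b x q : Fin (n + 1) → ℝ} (hx : x ∈ chamber (n + 1))
    (h : SpRel a b x q) : eigT a b = x := by
  rw [eigT, h.1]
  exact Rt_evs hx

lemma eigT_cons {n : ℕ} (a : Fin (n + 1) → ℝ) (s t : ℝ) (b : Fin n → ℝ) :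
    eigT a (Fin.cons s b) = eigT a (Fin.cons t b) := by
  simp [eigT, PN]

lemma eigT_jacobi {n : ℕ} (a : Fin (n + 1) → ℝ) (b : Fin n → ℝ) (hb : ∀ i, 0 < b i) :
    jacobiEigs (N := n + 1) a b = eigT a (Fin.cons 1 b) := by
  have hb' : ∀ i, 0 < (Fin.cons 1 b : Fin (n + 1) → ℝ) i := fun i =>
    Fin.cases (by simp) (fun j => by simpa using hb j) i
  obtain ⟨x, q, hx, hq, h⟩ := exists_rel a (Fin.cons 1 b) hb'
  rw [eigT_eq hx h]
  have := jacobiEigs_eq (fun i => (hb' i).le) hx h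
  simpa using this


/-- The key integral identity. -/
lemma key_int (β μ σ : ℝ) (hσ : 0 < σ) (n : ℕ) {f : (Fin (n + 1) → ℝ) → ℝ≥0∞}
    (hf : Measurable f) :
    (∫⁻ t, hE (β / 2 * ((n : ℝ) + 1)) σ t) *
      ∫⁻ a : Fin (n + 1) → ℝ, ∫⁻ b : Fin n → ℝ, f (eigT a (Fin.cons 1 b)) * dA μ σ a * dB β σ b =
    (∫⁻ q : Fin (n + 1) → ℝ, dQ β σ q) * ∫⁻ x, f x * wE (n + 1) β μ σ x := by
  have h := main_S β μ σ hσ (n + 1) (fun p => f (eigT p.1 p.2)) (fun p => f p.1) (by fun_prop)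
    (by fun_prop) (fun a b x q _ hx _ hr => by simp only [eigT_eq hx hr])
  have r : ∀ x, ∫⁻ q : Fin (n + 1) → ℝ, f x * wE (n + 1) β μ σ x * dQ β σ q =
      f x * wE (n + 1) β μ σ x * ∫⁻ q : Fin (n + 1) → ℝ, dQ β σ q := fun x =>
    lintegral_const_mul _ (by fun_prop)
  simp only [r] at h
  rw [lintegral_mul_const _ (by fun_prop)] at h
  rw [mul_comm (∫⁻ q : Fin (n + 1) → ℝ, dQ β σ q), ← h]
  have hm2 : ∀ a : Fin (n + 1) → ℝ,
      Measurable fun b : Fin n → ℝ => f (eigT a (Fin.cons 1 b)) * dA μ σ a * dB β σ b := fun a => by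
    fun_prop
  have hm3 : Measurable fun p : (Fin (n + 1) → ℝ) × (Fin n → ℝ) =>
      f (eigT p.1 (Fin.cons 1 p.2)) * dA μ σ p.1 * dB β σ p.2 :=
    by fun_prop
  rw [← lintegral_const_mul _ hm3.lintegral_prod_right']
  refine lintegral_congr fun a => ?_
  rw [vol_split (by fun_prop)]
  rw [← lintegral_mul_const _ (by fun_prop)]
  refine lintegral_congr fun t => ?_
  rw [← lintegral_const_mul _ (hm2 a)]
  refine lintegral_congr fun w => ?_
  rw [dB_cons, eigT_cons a t 1]
  ring

lemma final_int (β μ σ : ℝ) (hβ : 0 < β) (hσ : 0 < σ) (n : ℕ) (γ : Measure ℝ)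
    [IsProbabilityMeasure γ] (hγ : ∃ c : ℝ≥0∞, c ≠ 0 ∧ c ≠ ⊤ ∧
      γ = volume.withDensity (fun t => c * gE μ σ t)) :
    ∃ c : ℝ≥0∞, c ≠ 0 ∧ c ≠ ⊤ ∧ ∀ f : (Fin (n + 1) → ℝ) → ℝ≥0∞, Measurable f →
      ∫⁻ p, f (eigT p.1 (Fin.cons 1 p.2))
        ∂((Measure.pi fun _ : Fin (n + 1) => γ).prod
          (Measure.pi fun k : Fin n =>
            gammaMeasure (β / 2 * (((n + 1 : ℕ) : ℝ) - (((k : ℕ) : ℝ) + 1))) (σ ^ 2)⁻¹)) =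
      c * ∫⁻ x, f x * wE (n + 1) β μ σ x := by
  have hs : ∀ k : Fin n, 0 < β / 2 * ((n : ℝ) - ((k : ℕ) : ℝ)) := fun k => by
    have : ((k : ℕ) : ℝ) < n := by exact_mod_cast k.isLt
    have : 0 < (n : ℝ) - ((k : ℕ) : ℝ) := by linarith
    positivity
  have es : ∀ k : Fin n, β / 2 * (((n + 1 : ℕ) : ℝ) - (((k : ℕ) : ℝ) + 1)) =
      β / 2 * ((n : ℝ) - ((k : ℕ) : ℝ)) := fun k => by push_cast; ring
  simp only [es]
  obtain ⟨cg, cg0, cg1, hg⟩ := hγ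
  choose ch ch0 ch1 hh using fun k : Fin n => gamma_eq _ σ (hs k) hσ
  have hp : ∀ k : Fin n, IsProbabilityMeasure
      (gammaMeasure (β / 2 * ((n : ℝ) - ((k : ℕ) : ℝ))) (σ ^ 2)⁻¹) := fun k =>
    isProbabilityMeasure_gammaMeasure (hs k) (by positivity)
  obtain ⟨z0, z1⟩ := hE_int (β / 2 * ((n : ℝ) + 1)) σ (by positivity) hσ
  obtain ⟨q0, q1⟩ := dQ_int β σ hβ hσ (n + 1)
  set Z := ∫⁻ t, hE (β / 2 * ((n : ℝ) + 1)) σ t with hZ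
  set Q := ∫⁻ q : Fin (n + 1) → ℝ, dQ β σ q with hQ
  have hc0 : cg ^ (n + 1) * ∏ k, ch k ≠ 0 :=
    mul_ne_zero (pow_ne_zero _ cg0) (Finset.prod_ne_zero_iff.2 fun k _ => ch0 k)
  have hc1 : cg ^ (n + 1) * ∏ k, ch k ≠ ⊤ :=
    ENNReal.mul_ne_top (ENNReal.pow_ne_top cg1) (ENNReal.prod_ne_top fun k _ => ch1 k)
  refine ⟨cg ^ (n + 1) * (∏ k, ch k) * (Z⁻¹ * Q), mul_ne_zero hc0
    (mul_ne_zero (ENNReal.inv_ne_zero.2 z1) q0), ENNReal.mul_ne_top hc1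
    (ENNReal.mul_ne_top (ENNReal.inv_ne_top.2 z0) q1), fun f hf => ?_⟩
  have hm : Measurable fun p : (Fin (n + 1) → ℝ) × (Fin n → ℝ) =>
      f (eigT p.1 (Fin.cons 1 p.2)) := by fun_prop
  have hm3 : Measurable fun p : (Fin (n + 1) → ℝ) × (Fin n → ℝ) =>
      f (eigT p.1 (Fin.cons 1 p.2)) * dA μ σ p.1 * dB β σ p.2 :=
    (hm.mul (by fun_prop)).mul (by fun_prop)
  rw [lintegral_prod _ hm.aemeasurable, pi_dens _ (fun _ t => cg * gE μ σ t)
    (fun _ => by fun_prop) (fun _ => hg) hm.lintegral_prod_right']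
  have e1 : ∀ a : Fin (n + 1) → ℝ, ∫⁻ b, f (eigT a (Fin.cons 1 b))
      ∂(Measure.pi fun k : Fin n =>
        gammaMeasure (β / 2 * ((n : ℝ) - ((k : ℕ) : ℝ))) (σ ^ 2)⁻¹) =
      ∫⁻ b : Fin n → ℝ, f (eigT a (Fin.cons 1 b)) *
        ∏ k : Fin n, (ch k * hE (β / 2 * ((n : ℝ) - ((k : ℕ) : ℝ))) σ (b k)) := fun a =>
    pi_dens _ (fun k t => ch k * hE (β / 2 * ((n : ℝ) - ((k : ℕ) : ℝ))) σ t)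
      (fun _ => by fun_prop) hh (by fun_prop)
  have e2 : ∀ a : Fin (n + 1) → ℝ, (∫⁻ b, f (eigT a (Fin.cons 1 b))
      ∂(Measure.pi fun k : Fin n =>
        gammaMeasure (β / 2 * ((n : ℝ) - ((k : ℕ) : ℝ))) (σ ^ 2)⁻¹)) *
        ∏ i, (cg * gE μ σ (a i)) =
      cg ^ (n + 1) * (∏ k, ch k) *
        ∫⁻ b : Fin n → ℝ, f (eigT a (Fin.cons 1 b)) * dA μ σ a * dB β σ b := by
    intro a
    have hma : Measurable fun b : Fin n → ℝ => f (eigT a (Fin.cons 1 b)) :=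
      by fun_prop
    have hmb : Measurable fun b : Fin n → ℝ => f (eigT a (Fin.cons 1 b)) *
        ∏ k, ch k * hE (β / 2 * (↑n - ↑↑k)) σ (b k) := hma.mul (by fun_prop)
    have hmc : Measurable fun b : Fin n → ℝ => f (eigT a (Fin.cons 1 b)) * dA μ σ a *
        dB β σ b := (hma.mul_const _).mul (by fun_prop)
    rw [e1, ← lintegral_mul_const _ hmb, ← lintegral_const_mul _ hmc]
    refine lintegral_congr fun b => ?_
    rw [Finset.prod_mul_distrib, Finset.prod_mul_distrib, Finset.prod_const, Finset.card_univ,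
      Fintype.card_fin, dA, dB]
    ring
  simp only [e2]
  rw [lintegral_const_mul _ hm3.lintegral_prod_right']
  have hk := key_int β μ σ hσ n hf
  rw [mul_assoc (cg ^ (n + 1) * ∏ k, ch k), mul_assoc Z⁻¹, ← hk, ← mul_assoc Z⁻¹,
    ENNReal.inv_mul_cancel z0 z1, one_mul]

lemma gamma_ae_pos (s σ : ℝ) (hs : 0 < s) (hσ : 0 < σ) :
    ∀ᵐ t ∂(gammaMeasure s (σ ^ 2)⁻¹), 0 < t := by
  obtain ⟨c, -, -, hc⟩ := gamma_eq s σ hs hσ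
  rw [hc, ae_withDensity_iff (by fun_prop)]
  refine ae_of_all _ fun t ht => hE_ne (right_ne_zero_of_mul ht)

lemma final_map (β μ σ : ℝ) (hβ : 0 < β) (hσ : 0 < σ) (n : ℕ) (γ : Measure ℝ)
    [IsProbabilityMeasure γ] (hγ : ∃ c : ℝ≥0∞, c ≠ 0 ∧ c ≠ ⊤ ∧
      γ = volume.withDensity (fun t => c * gE μ σ t)) :
    ∃ c : ℝ≥0∞, c ≠ 0 ∧ c ≠ ⊤ ∧
      Measure.map (fun p : (Fin (n + 1) → ℝ) × (Fin n → ℝ) => jacobiEigs (N := n + 1) p.1 p.2)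
        ((Measure.pi fun _ : Fin (n + 1) => γ).prod
          (Measure.pi fun k : Fin n =>
            gammaMeasure (β / 2 * (((n + 1 : ℕ) : ℝ) - (((k : ℕ) : ℝ) + 1))) (σ ^ 2)⁻¹)) =
      c • (volume.withDensity (wE (n + 1) β μ σ)) := by
  have hs : ∀ k : Fin n, 0 < β / 2 * (((n + 1 : ℕ) : ℝ) - (((k : ℕ) : ℝ) + 1)) := fun k => by
    have h1 : ((k : ℕ) : ℝ) < n := by exact_mod_cast k.isLt
    have h2 : 0 < ((n + 1 : ℕ) : ℝ) - (((k : ℕ) : ℝ) + 1) := by push_cast; linarith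
    positivity
  have hp : ∀ k : Fin n, IsProbabilityMeasure
      (gammaMeasure (β / 2 * (((n + 1 : ℕ) : ℝ) - (((k : ℕ) : ℝ) + 1))) (σ ^ 2)⁻¹) := fun k =>
    isProbabilityMeasure_gammaMeasure (hs k) (by positivity)
  obtain ⟨c, c0, c1, h⟩ := final_int β μ σ hβ hσ n γ hγ
  refine ⟨c, c0, c1, ?_⟩
  set P := ((Measure.pi fun _ : Fin (n + 1) => γ).prod
          (Measure.pi fun k : Fin n =>
            gammaMeasure (β / 2 * (((n + 1 : ℕ) : ℝ) - (((k : ℕ) : ℝ) + 1))) (σ ^ 2)⁻¹)) with hP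
  have hae : ∀ᵐ p ∂P, ∀ k : Fin n, 0 < p.2 k := by
    rw [ae_all_iff]
    intro k
    have h1 : ∀ᵐ b ∂(Measure.pi fun k : Fin n =>
        gammaMeasure (β / 2 * (((n + 1 : ℕ) : ℝ) - (((k : ℕ) : ℝ) + 1))) (σ ^ 2)⁻¹), 0 < b k :=
      Measure.tendsto_eval_ae_ae.eventually (gamma_ae_pos _ σ (hs k) hσ)
    exact Measure.quasiMeasurePreserving_snd.tendsto_ae.eventually h1
  have hT : Measurable fun p : (Fin (n + 1) → ℝ) × (Fin n → ℝ) =>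
      eigT p.1 (Fin.cons 1 p.2) := by fun_prop
  rw [Measure.map_congr (g := fun p : (Fin (n + 1) → ℝ) × (Fin n → ℝ) =>
    eigT p.1 (Fin.cons 1 p.2))]
  · ext s hs
    rw [Measure.map_apply hT hs, Measure.smul_apply, withDensity_apply _ hs, smul_eq_mul]
    have h1 := h (s.indicator 1) (measurable_one.indicator hs)
    have e1 : ∀ p : (Fin (n + 1) → ℝ) × (Fin n → ℝ),
        s.indicator (1 : (Fin (n + 1) → ℝ) → ℝ≥0∞) (eigT p.1 (Fin.cons 1 p.2)) =
        ((fun p : (Fin (n + 1) → ℝ) × (Fin n → ℝ) =>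
          eigT p.1 (Fin.cons 1 p.2)) ⁻¹' s).indicator 1 p := fun p => rfl
    simp only [e1] at h1
    rw [lintegral_indicator_one (hT hs)] at h1
    rw [h1, ← lintegral_indicator hs]
    congr 1
    refine lintegral_congr fun x => ?_
    by_cases hx : x ∈ s <;> simp [hx]
  · filter_upwards [hae] with p hp
    exact eigT_jacobi p.1 p.2 hp

end

/-- tridiagonal model for the Hermite β-ensemble. -/
theorem hermite_beta_ensemble_tridiagonal
    (N : ℕ) (hN : 2 ≤ N) (β : ℝ) (hβ : 0 < β) (μ₀ σ : ℝ) (hσ : 0 < σ) :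
    ∃ c : ℝ≥0∞, c ≠ 0 ∧ c ≠ ⊤ ∧
      Measure.map
        (fun p : (Fin N → ℝ) × (Fin (N - 1) → ℝ) => jacobiEigs p.1 p.2)
        ((Measure.pi fun _ : Fin N => gaussianReal μ₀ ⟨σ ^ 2, sq_nonneg σ⟩).prod
          (Measure.pi fun n : Fin (N - 1) =>
            gammaMeasure (β / 2 * ((N : ℝ) - (((n : ℕ) : ℝ) + 1))) (σ ^ 2)⁻¹))
        = c • (volume.withDensity fun x : Fin N → ℝ =>
            ENNReal.ofReal ((chamber N).indicator
              (fun x => |vdm x| ^ β *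
                ∏ n : Fin N, Real.exp (-(x n - μ₀) ^ 2 / (2 * σ ^ 2))) x)) := by
  obtain ⟨n, rfl⟩ : ∃ n, N = n + 1 := ⟨N - 1, by omega⟩
  have : IsProbabilityMeasure (gaussianReal μ₀ ⟨σ ^ 2, sq_nonneg σ⟩) :=
    instIsProbabilityMeasureGaussianReal μ₀ _
  exact final_map β μ₀ σ hβ hσ n _ (gauss_eq μ₀ σ hσ)
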